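/- arXiv:1111.3011 — 3 statements merged into one kernel-verified Lean document; each statement's English description precedes it below -/
import Mathlib

section
/- Let A₁ and A₂ be selfadjoint (possibly unbounded) operators in a complex Hilbert space H with common point λ₀ in their resolvent sets such that the operator (A₁ - λ₀)⁻¹ - (A₂ - λ₀)⁻¹ has finite rank n. Let Δ be an open real interval disjoint from the essential spectrum of A₁. Then Δ is disjoint from the essential spectrum of A₂, and the total multiplicities of the eigenvalues of A₁ and A₂ in Δ differ by at most n. -/
open scoped InnerProductSpace

variable {H : Type*} [NormedAddCommGroup H] [InnerProductSpace ℂ H] [CompleteSpace H]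

/-- `R` is the (bounded, everywhere defined) resolvent of the (possibly unbounded)
operator `T` at the point `z`, i.e. `R = (T - z)⁻¹`. -/
def IsResolventAt (T : H →ₗ.[ℂ] H) (z : ℂ) (R : H →L[ℂ] H) : Prop :=
  (∀ x : T.domain, R (T x - z • (x : H)) = x) ∧
    ∀ y : H, ∃ hy : R y ∈ T.domain, T ⟨R y, hy⟩ - z • R y = y

/-- The resolvent set of the (possibly unbounded) operator `T`. -/
def pResolventSet (T : H →ₗ.[ℂ] H) : Set ℂ :=
  {z | ∃ R : H →L[ℂ] H, IsResolventAt T z R}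

/-- The spectrum of the (possibly unbounded) operator `T`. -/
def pSpectrum (T : H →ₗ.[ℂ] H) : Set ℂ :=
  (pResolventSet T)ᶜ

/-- The eigenspace of `T` at `μ`, as a subspace of `H`. -/
def eigSpaceP (T : H →ₗ.[ℂ] H) (μ : ℂ) : Submodule ℂ H :=
  (LinearMap.ker (T.toFun - μ • T.domain.subtype)).map T.domain.subtype

/-- The essential spectrum of `T`: the spectrum with the isolated eigenvalues of finite
multiplicity removed. -/
def essSpectrum (T : H →ₗ.[ℂ] H) : Set ℂ :=
  pSpectrum T \
    {z | (∃ U ∈ nhds z, pSpectrum T ∩ U = {z}) ∧ eigSpaceP T z ≠ ⊥ ∧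
      FiniteDimensional ℂ (eigSpaceP T z)}

/-- The span of the eigenspaces of `T` for eigenvalues in the real set `Δ`. -/
def eigSpanP (T : H →ₗ.[ℂ] H) (Δ : Set ℝ) : Submodule ℂ H :=
  ⨆ μ ∈ Δ, eigSpaceP T (μ : ℂ)


set_option linter.deprecated false
set_option linter.unusedSectionVars false

/-- The kernel of `1 - (t - lam0) R`. -/
def eR (lam0 : ℂ) (R : H →L[ℂ] H) (t : ℂ) : Submodule ℂ H :=
  LinearMap.ker ((1 - (t - lam0) • R : H →L[ℂ] H) : H →ₗ[ℂ] H)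

lemma mem_eR {lam0 : ℂ} {R : H →L[ℂ] H} {t : ℂ} {v : H} :
    v ∈ eR lam0 R t ↔ v = (t - lam0) • R v := by
  simp [eR, sub_eq_zero]

/-- Algebraic properties of a resolvent of a selfadjoint operator. -/
structure GoodRes (lam0 : ℂ) (R : H →L[ℂ] H) : Prop where
  inj : ∀ y, R y = 0 → y = 0
  normal : IsStarNormal R
  rel : R - star R = (lam0 - star lam0) • (star R * R)

lemma IsResolventAt.apply_sub {T : H →ₗ.[ℂ] H} {z : ℂ} {R : H →L[ℂ] H} (h : IsResolventAt T z R)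
    (t : ℂ) (y : H) (hy : R y ∈ T.domain) : T ⟨R y, hy⟩ - t • R y = y - (t - z) • R y := by
  obtain ⟨hy', h2⟩ := h.2 y
  have : T ⟨R y, hy⟩ = y + z • R y := by rw [← sub_eq_iff_eq_add]; exact h2
  rw [this]; module

lemma eigSpaceP_eq {T : H →ₗ.[ℂ] H} {z : ℂ} {R : H →L[ℂ] H} (h : IsResolventAt T z R) (t : ℂ) :
    eigSpaceP T t = eR z R t := by
  ext v
  rw [mem_eR]
  constructor
  · rintro ⟨x, hx, rfl⟩
    have hx' : T x - t • (x : H) = 0 := by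
      have := LinearMap.mem_ker.1 hx
      simpa using this
    have h1 := h.1 x
    have h2 : T x - z • (x : H) = (t - z) • (x : H) := by
      rw [sub_eq_zero] at hx'; rw [hx']; module
    rw [h2, map_smul] at h1
    exact h1.symm
  · intro hv
    obtain ⟨hy, -⟩ := h.2 v
    have hvd : v ∈ T.domain := by
      rw [hv]; exact T.domain.smul_mem _ hy
    have hy2 : R ((t - z) • v) ∈ T.domain := by rw [map_smul, ← hv]; exact hvd
    have h3 := h.apply_sub t ((t - z) • v) hy2
    refine ⟨⟨v, hvd⟩, ?_, rfl⟩
    have e : (⟨R ((t - z) • v), hy2⟩ : T.domain) = ⟨v, hvd⟩ := by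
      apply Subtype.ext; simp only [map_smul]; exact hv.symm
    rw [e, map_smul, ← hv, sub_self] at h3
    exact LinearMap.mem_ker.2 (by simpa using h3)

lemma mem_pResolventSet_iff {T : H →ₗ.[ℂ] H} {z : ℂ} {R : H →L[ℂ] H} (h : IsResolventAt T z R)
    (t : ℂ) : t ∈ pResolventSet T ↔ IsUnit (1 - (t - z) • R) := by
  constructor
  · rintro ⟨S, hS⟩
    have hSB : ∀ y, S (y - (t - z) • R y) = R y := by
      intro y
      obtain ⟨hy, -⟩ := h.2 y
      have := hS.1 ⟨R y, hy⟩
      rw [h.apply_sub t y hy] at this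
      exact this
    have hRC : ∀ y, R (y - (z - t) • S y) = S y := by
      intro y
      obtain ⟨hy, -⟩ := hS.2 y
      have := h.1 ⟨S y, hy⟩
      rw [hS.apply_sub z y hy] at this
      exact this
    refine ⟨⟨1 - (t - z) • R, 1 - (z - t) • S, ?_, ?_⟩, rfl⟩
    · ext y
      have := hRC y
      simp only [ContinuousLinearMap.mul_apply, ContinuousLinearMap.sub_apply,
        ContinuousLinearMap.one_apply, ContinuousLinearMap.smul_apply, this]
      module
    · ext y
      have := hSB y
      simp only [ContinuousLinearMap.mul_apply, ContinuousLinearMap.sub_apply,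
        ContinuousLinearMap.one_apply, ContinuousLinearMap.smul_apply, this]
      module
  · rintro ⟨u, hu⟩
    have hBC : ∀ y, (u.inv y) - (t - z) • R (u.inv y) = y := by
      intro y
      have := congrArg (fun f : H →L[ℂ] H => f y) u.val_inv
      rw [hu] at this
      simpa using this
    have hCB : ∀ y, u.inv (y - (t - z) • R y) = y := by
      intro y
      have := congrArg (fun f : H →L[ℂ] H => f y) u.inv_val
      rw [hu] at this
      simpa using this
    refine ⟨R * u.inv, ?_, ?_⟩
    · intro x
      have h1 := h.1 x
      set y := T x - z • (x : H) with hy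
      have h2 : T x - t • (x : H) = y - (t - z) • R y := by rw [h1, hy]; module
      rw [h2, ContinuousLinearMap.mul_apply, hCB, h1]
    · intro y
      obtain ⟨hy, -⟩ := h.2 (u.inv y)
      exact ⟨hy, (h.apply_sub t _ hy).trans (hBC y)⟩

lemma goodRes {T : H →ₗ.[ℂ] H} {z : ℂ} {R : H →L[ℂ] H} (hT : IsSelfAdjoint T)
    (h : IsResolventAt T z R) : GoodRes z R := by
  have hd := hT.dense_domain
  have hT' : T.adjoint = T := hT
  have hstar : ∀ y : H, ∃ hy : star R y ∈ T.domain, T ⟨star R y, hy⟩ = y + (star z) • star R y := by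
    intro y
    have key : ∀ x : T.domain, ⟪y + (star z) • star R y, (x : H)⟫_ℂ = ⟪star R y, T x⟫_ℂ := by
      intro x
      have h1 : ⟪star R y, T x - z • (x : H)⟫_ℂ = ⟪y, (x : H)⟫_ℂ := by
        rw [ContinuousLinearMap.star_eq_adjoint, ContinuousLinearMap.adjoint_inner_left, h.1 x]
      rw [inner_sub_right, inner_smul_right] at h1
      rw [inner_add_left, inner_smul_left, ← h1]
      simp
    have hm : star R y ∈ T.adjoint.domain := LinearPMap.mem_adjoint_domain_of_exists _ ⟨_, key⟩
    have e := LinearPMap.adjoint_apply_eq hd ⟨_, hm⟩ key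
    have : ∀ S : H →ₗ.[ℂ] H, S = T → ∀ (hm : star R y ∈ S.domain), 
        S ⟨star R y, hm⟩ = y + (star z) • star R y → 
        ∃ hy : star R y ∈ T.domain, T ⟨star R y, hy⟩ = y + (star z) • star R y := by
      rintro S rfl hm e
      exact ⟨hm, e⟩
    exact this _ hT' hm e
  have hinj : ∀ y, R y = 0 → y = 0 := by
    intro y hy
    obtain ⟨h1, -⟩ := h.2 y
    have := h.apply_sub z y h1
    have e : (⟨R y, h1⟩ : T.domain) = 0 := Subtype.ext hy
    rw [e, hy] at this
    simpa using this.symm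
  have rel1 : R - star R = (z - star z) • (R * star R) := by
    ext y
    obtain ⟨hy, h2⟩ := hstar y
    have h1 := h.1 ⟨star R y, hy⟩
    rw [h2] at h1
    have : R y + (star z - z) • R (star R y) = star R y := by
      rw [← map_smul, ← map_add]
      refine Eq.trans ?_ h1
      congr 1
      module
    simp only [ContinuousLinearMap.mul_apply, ContinuousLinearMap.sub_apply,
        ContinuousLinearMap.smul_apply]
    rw [sub_eq_iff_eq_add]
    nth_rw 2 [← this]
    module
  have rel2 : R - star R = (z - star z) • (star R * R) := by
    have hsym := LinearPMap.adjoint_isFormalAdjoint hd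
    rw [hT'] at hsym
    ext y
    refine ext_inner_left ℂ fun w => ?_
    obtain ⟨hy, h2⟩ := h.2 y
    obtain ⟨hw, h3⟩ := h.2 w
    have h4 := hsym ⟨R w, hw⟩ ⟨R y, hy⟩
    have h5 : T ⟨R y, hy⟩ = y + z • R y := by rw [← sub_eq_iff_eq_add]; exact h2
    have h6 : T ⟨R w, hw⟩ = w + z • R w := by rw [← sub_eq_iff_eq_add]; exact h3
    rw [h5, h6, inner_add_left, inner_add_right, inner_smul_left, inner_smul_right] at h4
    simp only [ContinuousLinearMap.mul_apply, ContinuousLinearMap.sub_apply,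
        ContinuousLinearMap.smul_apply, inner_sub_right, inner_smul_right,
        ContinuousLinearMap.star_eq_adjoint, ContinuousLinearMap.adjoint_inner_right]
    simp only [Complex.star_def]
    linear_combination h4
  refine ⟨hinj, ⟨?_⟩, rel2⟩
  by_cases hz : z - star z = 0
  · rw [hz, zero_smul, sub_eq_zero] at rel1
    rw [← rel1]
  · exact smul_right_injective _ hz (rel2.symm.trans rel1)

lemma pencil_iff {lam0 : ℂ} {R : H →L[ℂ] H} {s : ℂ} (hs : s ≠ lam0) :
    IsUnit (1 - (s - lam0) • R) ↔ (s - lam0)⁻¹ ∉ spectrum ℂ R := by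
  have h0 : s - lam0 ≠ 0 := sub_ne_zero.2 hs
  rw [spectrum.notMem_iff]
  have : (1 - (s - lam0) • R) = (Units.mk0 _ h0) • (algebraMap ℂ (H →L[ℂ] H) (s - lam0)⁻¹ - R) := by
    rw [Units.smul_mk0, smul_sub, Algebra.algebraMap_eq_smul_one, smul_smul, mul_inv_cancel₀ h0,
      one_smul]
  rw [this]
  exact isUnit_smul_iff _ _

lemma spec_real {lam0 : ℂ} {R : H →L[ℂ] H} (hR : GoodRes lam0 R) {z : ℂ} (hz : z ∈ spectrum ℂ R)
    (hz0 : z ≠ 0) : (lam0 + z⁻¹).im = 0 := by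
  have hn := hR.normal
  have e1 : cfc (fun w : ℂ => w - star w) R = R - star R := by
    rw [cfc_sub (fun w : ℂ => w) (fun w => star w), cfc_id' ℂ R, cfc_star_id R]
  have e2 : cfc (fun w : ℂ => (lam0 - star lam0) * (star w * w)) R
      = (lam0 - star lam0) • (star R * R) := by
    rw [cfc_const_mul (lam0 - star lam0) (fun w : ℂ => star w * w), cfc_mul (fun w : ℂ => star w)
      (fun w => w), cfc_id' ℂ R, cfc_star_id R]
  have h := eqOn_of_cfc_eq_cfc (e1.trans (hR.rel.trans e2.symm)) (by fun_prop) (by fun_prop) hn hz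
  simp only [Complex.star_def] at h
  have hc : (starRingEnd ℂ) z ≠ 0 := by simpa using hz0
  rw [← Complex.conj_eq_iff_im, map_add, map_inv₀]
  field_simp
  linear_combination h

lemma isUnit_of_im {lam0 : ℂ} {R : H →L[ℂ] H} (hR : GoodRes lam0 R) {s : ℂ} (hs : s.im ≠ 0) :
    IsUnit (1 - (s - lam0) • R) := by
  by_cases h : s = lam0
  · simp [h]
  · rw [pencil_iff h]
    intro hz
    apply hs
    have := spec_real hR hz (inv_ne_zero (sub_ne_zero.2 h))
    simpa using this

lemma finite_eig {lam0 : ℂ} {R : H →L[ℂ] H} (Δ : Set ℝ)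
    (hE : FiniteDimensional ℂ ↥(⨆ μ ∈ Δ, eR lam0 R ((μ : ℝ) : ℂ))) :
    {μ : ℝ | μ ∈ Δ ∧ eR lam0 R (μ : ℂ) ≠ ⊥}.Finite := by
  set S := {μ : ℝ | μ ∈ Δ ∧ eR lam0 R (μ : ℂ) ≠ ⊥} with hS
  have hex : ∀ μ : S, ∃ v ∈ eR lam0 R ((μ : ℝ) : ℂ), v ≠ 0 := fun μ =>
    Submodule.exists_mem_ne_zero_of_ne_bot μ.2.2
  choose v hv hv0 using hex
  have hne : ∀ μ : S, (((μ : ℝ) : ℂ) - lam0) ≠ 0 := by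
    intro μ h0
    have := mem_eR.1 (hv μ)
    rw [h0, zero_smul] at this
    exact hv0 μ this
  have hli : LinearIndependent ℂ v := by
    refine Module.End.eigenvectors_linearIndependent' (R : H →ₗ[ℂ] H)
      (fun μ : S => (((μ : ℝ) : ℂ) - lam0)⁻¹) ?_ v ?_
    · intro a b hab
      have := inv_injective hab
      exact Subtype.ext (by simpa using this)
    · intro μ
      refine ⟨?_, hv0 μ⟩
      rw [Module.End.mem_eigenspace_iff]
      have := mem_eR.1 (hv μ)
      conv_rhs => rw [this]
      rw [smul_smul, inv_mul_cancel₀ (hne μ), one_smul]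
      rfl
  have hmem : ∀ μ : S, v μ ∈ (⨆ μ ∈ Δ, eR lam0 R ((μ : ℝ) : ℂ)) := fun μ =>
    (le_iSup₂_of_le (f := fun (μ : ℝ) (_ : μ ∈ Δ) => eR lam0 R (μ : ℂ)) (μ : ℝ) μ.2.1 le_rfl) (hv μ)
  have hli2 : LinearIndependent ℂ (fun μ : S =>
      (⟨v μ, hmem μ⟩ : ↥(⨆ μ ∈ Δ, eR lam0 R ((μ : ℝ) : ℂ)))) :=
    LinearIndependent.of_comp (Submodule.subtype _) hli
  exact Set.finite_coe_iff.1 hli2.finite_of_isNoetherian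

lemma continuousOn_isolated {σ U : Set ℂ} {h : ℂ → ℂ} (hU : IsOpen U) (hf : (σ ∩ U).Finite)
    (hc : ContinuousOn h (σ \ U)) : ContinuousOn h σ := by
  intro z hz
  by_cases hzU : z ∈ U
  · have hfin : ((σ ∩ U) \ {z}).Finite := hf.subset Set.diff_subset
    have h1 : U ∩ ((σ ∩ U) \ {z})ᶜ ∈ nhds z :=
      Filter.inter_mem (hU.mem_nhds hzU) (hfin.isClosed.isOpen_compl.mem_nhds (by simp))
    have h2 : ContinuousWithinAt h (σ ∩ (U ∩ ((σ ∩ U) \ {z})ᶜ)) z := by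
      have : σ ∩ (U ∩ ((σ ∩ U) \ {z})ᶜ) ⊆ {z} := by
        rintro w ⟨hw, hwU, hw2⟩
        by_contra hne
        exact hw2 ⟨⟨hw, hwU⟩, hne⟩
      exact continuousWithinAt_singleton.mono this
    exact (continuousWithinAt_inter h1).1 h2
  · have h1 : (σ ∩ U)ᶜ ∈ nhds z := hf.isClosed.isOpen_compl.mem_nhds (fun hh => hzU hh.2)
    have h2 : ContinuousWithinAt h (σ ∩ (σ ∩ U)ᶜ) z := by
      refine (hc z ⟨hz, hzU⟩).mono ?_
      rintro w ⟨hw, hw2⟩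
      exact ⟨hw, fun hh => hw2 ⟨hw, hh⟩⟩
    exact (continuousWithinAt_inter h1).1 h2

lemma gap {lam0 : ℂ} {R : H →L[ℂ] H} (hR : GoodRes lam0 R) (Δ : Set ℝ)
    (hE : FiniteDimensional ℂ ↥(⨆ μ ∈ Δ, eR lam0 R ((μ : ℝ) : ℂ)))
    (hΔ : ∀ t ∈ Δ, IsUnit (1 - ((t : ℂ) - lam0) • R) ∨ eR lam0 R (t : ℂ) ≠ ⊥)
    (c r : ℝ) (hr : 0 < r) (hcr : Set.Ioo (c - r) (c + r) ⊆ Δ) (y : H)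
    (hy : R y ∈ (⨆ μ ∈ Δ, eR lam0 R ((μ : ℝ) : ℂ))ᗮ) :
    r * ‖R y‖ ≤ ‖y - ((c : ℂ) - lam0) • R y‖ := by
  have hn := hR.normal
  set E := ⨆ μ ∈ Δ, eR lam0 R ((μ : ℝ) : ℂ) with hEdef
  set U : Set ℂ := {z | z ≠ 0 ∧ (lam0 + z⁻¹).re ∈ Set.Ioo (c - r) (c + r)} with hUdef
  have hU : IsOpen U := by
    have hcont : ContinuousOn (fun z : ℂ => (lam0 + z⁻¹).re) {z | z ≠ 0} := by
      refine Complex.continuous_re.comp_continuousOn (continuousOn_const.add ?_)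
      exact continuousOn_inv₀
    exact hcont.isOpen_inter_preimage isOpen_ne isOpen_Ioo
  -- points of the spectrum in U
  have hpt : ∀ z ∈ spectrum ℂ R ∩ U, ∃ μ ∈ Δ, eR lam0 R ((μ : ℝ) : ℂ) ≠ ⊥ ∧
      (μ : ℂ) - lam0 ≠ 0 ∧ z = ((μ : ℂ) - lam0)⁻¹ := by
    rintro z ⟨hz, hz0, hzJ⟩
    have him := spec_real hR hz hz0
    set μ := (lam0 + z⁻¹).re with hμ
    have hμ' : (μ : ℂ) = lam0 + z⁻¹ := Complex.ext (by simp [hμ]) (by rw [him]; simp)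
    have hd : (μ : ℂ) - lam0 = z⁻¹ := by rw [hμ']; ring
    have hne : (μ : ℂ) - lam0 ≠ 0 := by rw [hd]; exact inv_ne_zero hz0
    have hzz : z = ((μ : ℂ) - lam0)⁻¹ := by rw [hd, inv_inv]
    refine ⟨μ, hcr hzJ, ?_, hne, hzz⟩
    rcases hΔ μ (hcr hzJ) with h | h
    · rw [pencil_iff (sub_ne_zero.1 hne), ← hzz] at h
      exact absurd hz h
    · exact h
  have hfin : (spectrum ℂ R ∩ U).Finite := by
    refine ((finite_eig Δ hE).image (fun μ : ℝ => ((μ : ℂ) - lam0)⁻¹)).subset ?_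
    intro z hz
    obtain ⟨μ, h1, h2, -, h3⟩ := hpt z hz
    exact ⟨μ, ⟨h1, h2⟩, h3.symm⟩
  have hbd : ∀ z ∈ spectrum ℂ R, z ∉ U → r * ‖z‖ ≤ ‖1 - ((c : ℂ) - lam0) * z‖ := by
    intro z hz hzU
    by_cases hz0 : z = 0
    · simp [hz0]
    have him := spec_real hR hz hz0
    set μ := (lam0 + z⁻¹).re with hμ
    have hμ' : (μ : ℂ) = lam0 + z⁻¹ := Complex.ext (by simp [hμ]) (by rw [him]; simp)
    have e : 1 - ((c : ℂ) - lam0) * z = ((μ - c : ℝ) : ℂ) * z := by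
      push_cast; rw [hμ']; field_simp; ring
    rw [e, norm_mul, Complex.norm_real]
    gcongr
    rw [Real.norm_eq_abs]
    by_contra hlt
    push Not at hlt
    rw [abs_lt] at hlt
    exact hzU ⟨hz0, by constructor <;> linarith⟩
  have hden : ∀ z ∈ spectrum ℂ R, z ∉ U → 1 - ((c : ℂ) - lam0) * z ≠ 0 := by
    intro z hz hzU h0
    have := hbd z hz hzU
    rw [h0, norm_zero] at this
    have hz0 : ‖z‖ = 0 := by
      have := norm_nonneg z
      nlinarith
    rw [norm_eq_zero] at hz0
    rw [hz0] at h0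
    simp at h0
  classical
  set g : ℂ → ℂ := fun z => if z ∈ U then 0 else z / (1 - ((c : ℂ) - lam0) * z) with hg
  have hgc : ContinuousOn g (spectrum ℂ R) := by
    refine continuousOn_isolated hU hfin ?_
    have : ContinuousOn (fun z : ℂ => z / (1 - ((c : ℂ) - lam0) * z)) (spectrum ℂ R \ U) := by
      refine ContinuousOn.div continuousOn_id (by fun_prop) ?_
      intro z hz
      exact hden z hz.1 hz.2
    refine this.congr ?_
    intro z hz
    simp [hg, hz.2]
  have hgn : ‖cfc g R‖ ≤ r⁻¹ := by
    refine norm_cfc_le (by positivity) ?_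
    intro z hz
    by_cases hzU : z ∈ U
    · simp [hg, hzU]; positivity
    · simp only [hg, hzU, if_false, norm_div]
      have h1 := hbd z hz hzU
      have h2 : 0 < ‖1 - ((c : ℂ) - lam0) * z‖ := norm_pos_iff.2 (hden z hz hzU)
      rw [div_le_iff₀ h2, inv_mul_eq_div, le_div_iff₀ hr]
      linarith
  set χ : ℂ → ℂ → ℂ := fun f z => if z = f then 1 else 0 with hχ
  have hχc : ∀ f ∈ spectrum ℂ R ∩ U, ContinuousOn (χ f) (spectrum ℂ R) := by
    intro f hf
    refine continuousOn_isolated hU hfin ?_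
    refine (continuousOn_const (c := (0 : ℂ))).congr ?_
    intro z hz
    have : z ≠ f := by rintro rfl; exact hz.2 hf.2
    simp [hχ, this]
  have hQ : ∀ f ∈ spectrum ℂ R ∩ U, cfc (χ f) R (R y) = 0 := by
    intro f hf
    have hc := hχc f hf
    obtain ⟨μ, hμΔ, -, hne, hfμ⟩ := hpt f hf
    have hQE : ∀ w, cfc (χ f) R w ∈ E := by
      intro w
      have h1 : R * cfc (χ f) R = f • cfc (χ f) R := by
        conv_lhs => rw [← cfc_id' ℂ R, cfc_id' ℂ R]
        nth_rw 1 [← cfc_id' ℂ R]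
        rw [← cfc_mul (fun z : ℂ => z) (χ f) R, ← cfc_const_mul f (χ f) R]
        refine cfc_congr ?_
        intro z _
        simp only [hχ]
        split_ifs with h
        · rw [h]
        · simp
      have h2 : R (cfc (χ f) R w) = f • cfc (χ f) R w := by
        have := congrArg (fun A : H →L[ℂ] H => A w) h1
        simpa using this
      refine (le_iSup₂_of_le (f := fun (μ : ℝ) (_ : μ ∈ Δ) => eR lam0 R (μ : ℂ)) μ hμΔ le_rfl) ?_
      rw [mem_eR, h2, smul_smul, hfμ, mul_inv_cancel₀ hne, one_smul]
    have h3 : star (cfc (χ f) R) * cfc (χ f) R = cfc (χ f) R := by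
      rw [← cfc_star, ← cfc_mul _ _ R (by
        refine ContinuousOn.congr hc ?_
        intro z _
        simp only [hχ]; split_ifs <;> simp) hc]
      refine cfc_congr ?_
      intro z _
      simp only [hχ]; split_ifs <;> simp
    have h4 : ⟪cfc (χ f) R (R y), cfc (χ f) R (R y)⟫_ℂ = 0 := by
      rw [← ContinuousLinearMap.adjoint_inner_right, ← ContinuousLinearMap.star_eq_adjoint,
        ← ContinuousLinearMap.mul_apply, h3]
      exact Submodule.inner_left_of_mem_orthogonal (hQE _) hy
    exact inner_self_eq_zero.1 h4
  have hmain : cfc g R * (1 - ((c : ℂ) - lam0) • R)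
      = R - ∑ f ∈ hfin.toFinset, cfc (χ f) R * R := by
    have e1 : (1 - ((c : ℂ) - lam0) • R) = cfc (fun z : ℂ => 1 - ((c : ℂ) - lam0) * z) R := by
      rw [cfc_sub (fun _ : ℂ => 1) (fun z => ((c : ℂ) - lam0) * z), cfc_const_one ℂ R,
        cfc_const_mul_id _ R]
    have e2 : ∀ f ∈ hfin.toFinset, cfc (χ f) R * R = cfc (fun z => χ f z * z) R := by
      intro f hf
      rw [cfc_mul (χ f) (fun z => z) R (hχc f (hfin.mem_toFinset.1 hf)), cfc_id' ℂ R]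
    have hc2 : ∀ f ∈ hfin.toFinset, ContinuousOn (fun z => χ f z * z) (spectrum ℂ R) := by
      intro f hf
      exact (hχc f (hfin.mem_toFinset.1 hf)).mul continuousOn_id
    rw [Finset.sum_congr rfl e2, ← cfc_sum _ R _ hc2, e1, ← cfc_mul g _ R hgc]
    refine Eq.trans ?_ (congrArg (fun A => A - cfc (∑ i ∈ hfin.toFinset, fun z => χ i z * z) R)
      (cfc_id' ℂ R))
    rw [← cfc_sub (fun z : ℂ => z) _ R continuousOn_id (by
      have := continuousOn_finset_sum hfin.toFinset hc2
      refine this.congr ?_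
      intro z _
      simp)]
    refine cfc_congr ?_
    intro z hz
    simp only [hg, hχ, Finset.sum_apply, ite_mul, one_mul, zero_mul, Finset.sum_ite_eq,
      Set.Finite.mem_toFinset]
    by_cases hzU : z ∈ U
    · simp [hzU, hz]
    · simp only [hzU, if_false, Set.mem_inter_iff, and_false, sub_zero]
      rw [div_mul_cancel₀ _ (hden z hz hzU)]
  have hfinal : cfc g R (y - ((c : ℂ) - lam0) • R y) = R y := by
    have := congrArg (fun A : H →L[ℂ] H => A y) hmain
    simp only [ContinuousLinearMap.mul_apply, ContinuousLinearMap.sub_apply,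
      ContinuousLinearMap.one_apply, ContinuousLinearMap.smul_apply,
      ContinuousLinearMap.sum_apply] at this
    rw [this, Finset.sum_eq_zero, sub_zero]
    intro f hf
    exact hQ f (hfin.mem_toFinset.1 hf)
  have := (cfc g R).le_of_opNorm_le hgn (y - ((c : ℂ) - lam0) • R y)
  rw [hfinal, inv_mul_eq_div, le_div_iff₀ hr] at this
  linarith

lemma star_eig {lam0 : ℂ} {R : H →L[ℂ] H} (hR : GoodRes lam0 R) {t : ℂ} {v : H}
    (hv : v ∈ eR lam0 R t) : v = (t - star lam0) • star R v := by
  have h1 := congrArg (fun A : H →L[ℂ] H => A v) hR.rel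
  simp only [ContinuousLinearMap.mul_apply, ContinuousLinearMap.sub_apply,
    ContinuousLinearMap.smul_apply] at h1
  have h2 := mem_eR.1 hv
  have h3 : (t - lam0) • (R v - star R v) = (lam0 - star lam0) • star R v := by
    rw [h1]
    conv_rhs => rw [h2, map_smul]
    rw [smul_comm]
  rw [smul_sub, ← h2, sub_eq_iff_eq_add] at h3
  refine h3.trans ?_
  module

lemma eig_orth {lam0 : ℂ} {R : H →L[ℂ] H} (hR : GoodRes lam0 R) {t s : ℝ} (hts : t ≠ s) {v w : H}
    (hv : v ∈ eR lam0 R (t : ℂ)) (hw : w ∈ eR lam0 R (s : ℂ)) : ⟪v, w⟫_ℂ = 0 := by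
  have h1 : ⟪v, w⟫_ℂ = ((t : ℂ) - lam0) * ⟪star R v, w⟫_ℂ := by
    conv_lhs => rw [star_eig hR hv, inner_smul_left]
    simp
  have h2 : ⟪v, w⟫_ℂ = ((s : ℂ) - lam0) * ⟪star R v, w⟫_ℂ := by
    conv_lhs => rw [mem_eR.1 hw, inner_smul_right]
    rw [ContinuousLinearMap.star_eq_adjoint, ContinuousLinearMap.adjoint_inner_left]
  have h3 : ((t : ℂ) - s) * ⟪star R v, w⟫_ℂ = 0 := by linear_combination h2 - h1
  have h4 : (t : ℂ) - s ≠ 0 := by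
    rw [sub_ne_zero]; exact_mod_cast hts
  rw [h1, (mul_eq_zero.1 h3).resolve_left h4, mul_zero]

lemma eR_invariant {lam0 : ℂ} {R : H →L[ℂ] H} {t : ℂ} {v : H}
    (hv : v ∈ eR lam0 R t) : R v ∈ eR lam0 R t := by
  rw [mem_eR, ← map_smul]
  exact congrArg R (mem_eR.1 hv)

lemma small_on_span {lam0 : ℂ} {R : H →L[ℂ] H} (hR : GoodRes lam0 R) {Δ : Set ℝ} (S : Finset Δ)
    (c ρ : ℝ) (hρ : 0 ≤ ρ) (hS : ∀ μ ∈ S, |(μ : ℝ) - c| ≤ ρ) (y : H)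
    (hy : y ∈ ⨆ μ ∈ S, eR lam0 R (((μ : Δ) : ℝ) : ℂ)) :
    ‖y - ((c : ℂ) - lam0) • R y‖ ≤ ρ * ‖R y‖ := by
  rw [Submodule.mem_iSup_finset_iff_exists_sum] at hy
  obtain ⟨l, rfl⟩ := hy
  have hO : OrthogonalFamily ℂ (fun μ : Δ => eR lam0 R ((μ : ℝ) : ℂ))
      (fun μ => (eR lam0 R ((μ : ℝ) : ℂ)).subtypeₗᵢ) := by
    intro a b hab v w
    exact eig_orth hR (fun h => hab (Subtype.ext h)) v.2 w.2
  set u : ∀ μ : Δ, eR lam0 R ((μ : ℝ) : ℂ) := fun μ => ⟨R (l μ), eR_invariant (l μ).2⟩ with hu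
  have e1 : R (∑ μ ∈ S, (l μ : H)) = ∑ μ ∈ S, (eR lam0 R ((μ : ℝ) : ℂ)).subtypeₗᵢ (u μ) := by
    rw [map_sum]; rfl
  have e2 : (∑ μ ∈ S, (l μ : H)) - ((c : ℂ) - lam0) • R (∑ μ ∈ S, (l μ : H)) =
      ∑ μ ∈ S, (eR lam0 R ((μ : ℝ) : ℂ)).subtypeₗᵢ (((((μ : ℝ) - c : ℝ)) : ℂ) • u μ) := by
    rw [map_sum, Finset.smul_sum, ← Finset.sum_sub_distrib]
    refine Finset.sum_congr rfl fun μ _ => ?_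
    have : (eR lam0 R ((μ : ℝ) : ℂ)).subtypeₗᵢ (((((μ : ℝ) - c : ℝ)) : ℂ) • u μ)
      = ((((μ : ℝ) - c : ℝ)) : ℂ) • R (l μ) := rfl
    rw [this]
    nth_rw 1 [mem_eR.1 (l μ).2]
    push_cast
    module
  rw [e2, e1]
  refine (sq_le_sq₀ (norm_nonneg _) (mul_nonneg hρ (norm_nonneg _))).1 ?_
  rw [mul_pow, hO.norm_sum, hO.norm_sum, Finset.mul_sum]
  refine Finset.sum_le_sum fun μ hμ => ?_
  rw [norm_smul, mul_pow, Complex.norm_real, Real.norm_eq_abs]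
  gcongr
  exact hS μ hμ

/-- The map whose kernel is the set on which the two resolvents agree with value orthogonal
to `E`. -/
noncomputable def obstr (R₁ R₂ : H →L[ℂ] H) (E : Submodule ℂ H) [FiniteDimensional ℂ E] :
    H →ₗ[ℂ] (LinearMap.range ((R₁ - R₂ : H →L[ℂ] H) : H →ₗ[ℂ] H)) × E :=
  (LinearMap.rangeRestrict ((R₁ - R₂ : H →L[ℂ] H) : H →ₗ[ℂ] H)).prod
    ((E.orthogonalProjectionOnto ∘L R₂ : H →L[ℂ] E) : H →ₗ[ℂ] E)

lemma obstr_eq_zero {R₁ R₂ : H →L[ℂ] H} {E : Submodule ℂ H} [FiniteDimensional ℂ E] {y : H} :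
    obstr R₁ R₂ E y = 0 ↔ R₁ y - R₂ y = 0 ∧ E.orthogonalProjectionOnto (R₂ y) = 0 := by
  rw [obstr, LinearMap.prod_apply, Prod.ext_iff]
  refine and_congr ?_ Iff.rfl
  rw [Subtype.ext_iff]
  rfl

lemma obstr_ker {R₁ R₂ : H →L[ℂ] H} {E : Submodule ℂ H} [FiniteDimensional ℂ E] {y : H}
    (h : obstr R₁ R₂ E y = 0) : R₁ y = R₂ y ∧ R₁ y ∈ Eᗮ := by
  obtain ⟨h1, h2⟩ := obstr_eq_zero.1 h
  rw [sub_eq_zero] at h1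
  refine ⟨h1, ?_⟩
  rw [h1]
  exact Submodule.orthogonalProjectionOnto_eq_zero_iff.1 h2

lemma count_aux {lam0 : ℂ} {R₁ R₂ : H →L[ℂ] H} (hR₁ : GoodRes lam0 R₁) (hR₂ : GoodRes lam0 R₂)
    (Δ : Set ℝ) (hΔopen : IsOpen Δ) (hΔconn : Δ.OrdConnected)
    (hE : FiniteDimensional ℂ ↥(⨆ μ ∈ Δ, eR lam0 R₁ ((μ : ℝ) : ℂ)))
    (hΔ : ∀ t ∈ Δ, IsUnit (1 - ((t : ℂ) - lam0) • R₁) ∨ eR lam0 R₁ (t : ℂ) ≠ ⊥)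
    (hfin : FiniteDimensional ℂ ↥(LinearMap.range ((R₁ - R₂ : H →L[ℂ] H) : H →ₗ[ℂ] H)))
    (V : Submodule ℂ H) (hVfin : FiniteDimensional ℂ V)
    (hV : V ≤ ⨆ μ ∈ Δ, eR lam0 R₂ ((μ : ℝ) : ℂ)) :
    Module.finrank ℂ V ≤ Module.finrank ℂ ↥(LinearMap.range ((R₁ - R₂ : H →L[ℂ] H) : H →ₗ[ℂ] H))
      + Module.finrank ℂ ↥(⨆ μ ∈ Δ, eR lam0 R₁ ((μ : ℝ) : ℂ)) := by
  have hVfg : V.FG := (Submodule.fg_iff_finiteDimensional V).2 hVfin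
  rw [iSup_subtype'] at hV
  obtain ⟨S, hS⟩ := CompleteLattice.IsCompactElement.exists_finset_of_le_iSup _
    ((Submodule.fg_iff_compact V).1 hVfg) _ hV
  rcases S.eq_empty_or_nonempty with rfl | hne
  · have : V = ⊥ := by simpa using hS
    subst this
    simp
  set m := S.min' hne with hm
  set M := S.max' hne with hM
  obtain ⟨ε₁, hε₁, hb₁⟩ := Metric.isOpen_iff.1 hΔopen m m.2
  obtain ⟨ε₂, hε₂, hb₂⟩ := Metric.isOpen_iff.1 hΔopen M M.2
  have hmM : (m : ℝ) ≤ M :=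
    Subtype.coe_le_coe.2 (Finset.min'_le S M (Finset.max'_mem S hne))
  set ε := min ε₁ ε₂ with hε
  have hεpos : 0 < ε := lt_min hε₁ hε₂
  set c : ℝ := (m + M) / 2 with hc
  set ρ : ℝ := (M - m) / 2 with hρ
  have hρ0 : 0 ≤ ρ := by rw [hρ]; linarith
  have hsub : Set.Ioo (c - (ρ + ε)) (c + (ρ + ε)) ⊆ Δ := by
    rintro x ⟨hx1, hx2⟩
    have l1 : ε ≤ ε₁ := min_le_left _ _
    have l2 : ε ≤ ε₂ := min_le_right _ _
    rcases lt_or_ge x m with h | h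
    · apply hb₁
      rw [Metric.mem_ball, Real.dist_eq, abs_lt]
      constructor <;> linarith
    rcases lt_or_ge (M : ℝ) x with h' | h'
    · apply hb₂
      rw [Metric.mem_ball, Real.dist_eq, abs_lt]
      constructor <;> linarith
    · exact hΔconn.out m.2 M.2 ⟨h, h'⟩
  have hSρ : ∀ μ ∈ S, |(μ : ℝ) - c| ≤ ρ := by
    intro μ hμ
    have h1 : (m : ℝ) ≤ μ := Finset.min'_le _ _ hμ
    have h2 : (μ : ℝ) ≤ M := Finset.le_max' _ _ hμ
    rw [abs_le]
    constructor <;> linarith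
  rw [← Module.finrank_prod]
  refine LinearMap.finrank_le_finrank_of_injective
    (f := (obstr R₁ R₂ (⨆ μ ∈ Δ, eR lam0 R₁ ((μ : ℝ) : ℂ))).comp V.subtype) ?_
  rw [injective_iff_map_eq_zero]
  rintro ⟨y, hyV⟩ hy
  obtain ⟨h1, h2⟩ := obstr_ker (y := y) hy
  have g1 := gap hR₁ Δ hE hΔ c (ρ + ε) (by linarith) hsub y h2
  have g2 := small_on_span hR₂ S c ρ hρ0 hSρ y (hS hyV)
  rw [← h1] at g2
  have g3 : ‖R₁ y‖ = 0 := by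
    have := norm_nonneg (R₁ y)
    nlinarith
  exact Subtype.ext (hR₁.inj y (norm_eq_zero.1 g3))

lemma count {lam0 : ℂ} {R₁ R₂ : H →L[ℂ] H} (hR₁ : GoodRes lam0 R₁) (hR₂ : GoodRes lam0 R₂)
    (Δ : Set ℝ) (hΔopen : IsOpen Δ) (hΔconn : Δ.OrdConnected)
    (hE : FiniteDimensional ℂ ↥(⨆ μ ∈ Δ, eR lam0 R₁ ((μ : ℝ) : ℂ)))
    (hΔ : ∀ t ∈ Δ, IsUnit (1 - ((t : ℂ) - lam0) • R₁) ∨ eR lam0 R₁ (t : ℂ) ≠ ⊥)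
    (hfin : FiniteDimensional ℂ ↥(LinearMap.range ((R₁ - R₂ : H →L[ℂ] H) : H →ₗ[ℂ] H))) :
    FiniteDimensional ℂ ↥(⨆ μ ∈ Δ, eR lam0 R₂ ((μ : ℝ) : ℂ)) ∧
    Module.finrank ℂ ↥(⨆ μ ∈ Δ, eR lam0 R₂ ((μ : ℝ) : ℂ)) ≤
      Module.finrank ℂ ↥(LinearMap.range ((R₁ - R₂ : H →L[ℂ] H) : H →ₗ[ℂ] H))
      + Module.finrank ℂ ↥(⨆ μ ∈ Δ, eR lam0 R₁ ((μ : ℝ) : ℂ)) := by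
  have key := count_aux hR₁ hR₂ Δ hΔopen hΔconn hE hΔ hfin
  have hf : FiniteDimensional ℂ ↥(⨆ μ ∈ Δ, eR lam0 R₂ ((μ : ℝ) : ℂ)) := by
    refine Module.rank_lt_aleph0_iff.1 (lt_of_le_of_lt (rank_le (n := 
      Module.finrank ℂ ↥(LinearMap.range ((R₁ - R₂ : H →L[ℂ] H) : H →ₗ[ℂ] H))
      + Module.finrank ℂ ↥(⨆ μ ∈ Δ, eR lam0 R₁ ((μ : ℝ) : ℂ))) ?_) (Cardinal.natCast_lt_aleph0))
    intro s hs
    have hli := hs.map' (Submodule.subtype _) (Submodule.ker_subtype _)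
    have hfr := finrank_span_eq_card hli
    rw [Fintype.card_coe] at hfr
    rw [← hfr]
    refine key _ (FiniteDimensional.span_of_finite ℂ (Set.finite_range _)) ?_
    rw [Submodule.span_le]
    rintro _ ⟨i, rfl⟩
    exact (i : ↥(⨆ μ ∈ Δ, eR lam0 R₂ ((μ : ℝ) : ℂ))).2
  exact ⟨hf, key _ hf le_rfl⟩

lemma fredholm {lam0 : ℂ} {R₁ R₂ : H →L[ℂ] H} (hR₁ : GoodRes lam0 R₁) (hR₂ : GoodRes lam0 R₂)
    (Δ : Set ℝ) (hΔopen : IsOpen Δ)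
    (hE : FiniteDimensional ℂ ↥(⨆ μ ∈ Δ, eR lam0 R₁ ((μ : ℝ) : ℂ)))
    (hΔ : ∀ t ∈ Δ, IsUnit (1 - ((t : ℂ) - lam0) • R₁) ∨ eR lam0 R₁ (t : ℂ) ≠ ⊥)
    (hfin : FiniteDimensional ℂ ↥(LinearMap.range ((R₁ - R₂ : H →L[ℂ] H) : H →ₗ[ℂ] H)))
    (t : ℝ) (ht : t ∈ Δ) :
    IsUnit (1 - ((t : ℂ) - lam0) • R₂) ∨ eR lam0 R₂ (t : ℂ) ≠ ⊥ := by
  by_cases hbot : eR lam0 R₂ (t : ℂ) = ⊥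
  swap
  · exact Or.inr hbot
  left
  set B : H →L[ℂ] H := 1 - ((t : ℂ) - lam0) • R₂ with hB
  have hBy : ∀ y, B y = y - ((t : ℂ) - lam0) • R₂ y := fun y => by simp [hB]
  have hn := hR₂.normal
  have hBn : IsStarNormal B := by
    constructor
    have hc : Commute (star R₂) R₂ := hn.star_comm_self
    rw [hB, star_sub, star_one, star_smul]
    exact ((Commute.one_left _).sub_left
      (((Commute.one_right _).sub_right ((hc.smul_right _))).smul_left _))
  obtain ⟨r, hr, hball⟩ := Metric.isOpen_iff.1 hΔopen t ht
  have hsub : Set.Ioo (t - r) (t + r) ⊆ Δ := by rwa [← Real.ball_eq_Ioo]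
  set E := ⨆ μ ∈ Δ, eR lam0 R₁ ((μ : ℝ) : ℂ) with hEdef
  set W : Submodule ℂ H := LinearMap.ker (obstr R₁ R₂ E) with hW
  have hWclosed : IsClosed (W : Set H) := by
    have : (W : Set H) = {y | R₁ y - R₂ y = 0} ∩ {y | E.orthogonalProjectionOnto (R₂ y) = 0} := by
      ext y
      exact obstr_eq_zero
    rw [this]
    exact (isClosed_eq (by fun_prop) continuous_const).inter
      (isClosed_eq (by fun_prop) continuous_const)
  have hWc : CompleteSpace W := hWclosed.completeSpace_coe
  have hbelow : ∀ y ∈ W, ‖y‖ ≤ (1 + ‖(t : ℂ) - lam0‖ / r) * ‖B y‖ := by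
    intro y hy
    obtain ⟨h1, h2⟩ := obstr_ker (y := y) (LinearMap.mem_ker.1 hy)
    have g1 := gap hR₁ Δ hE hΔ t r hr hsub y h2
    rw [h1, ← hBy] at g1
    have g2 : ‖R₂ y‖ ≤ ‖B y‖ / r := by rw [le_div_iff₀ hr]; linarith
    have g3 : y = B y + ((t : ℂ) - lam0) • R₂ y := by rw [hBy]; abel
    calc ‖y‖ = ‖B y + ((t : ℂ) - lam0) • R₂ y‖ := by rw [← g3]
      _ ≤ ‖B y‖ + ‖(t : ℂ) - lam0‖ * ‖R₂ y‖ := by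
        rw [← norm_smul]; exact norm_add_le _ _
      _ ≤ ‖B y‖ + ‖(t : ℂ) - lam0‖ * (‖B y‖ / r) := by gcongr
      _ = _ := by ring
  have hBW : IsClosed ((W.map (B : H →ₗ[ℂ] H) : Submodule ℂ H) : Set H) := by
    have hanti : AntilipschitzWith (Real.toNNReal (1 + ‖(t : ℂ) - lam0‖ / r)) (B ∘L W.subtypeL) := by
      refine ContinuousLinearMap.antilipschitz_of_bound _ ?_
      intro y
      rw [Real.coe_toNNReal _ (by positivity)]
      exact hbelow y y.2
    have := hanti.isClosed_range (ContinuousLinearMap.uniformContinuous _)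
    convert this using 1
    ext x
    simp
  obtain ⟨F, hF⟩ := Submodule.exists_isCompl W
  have hFfin : FiniteDimensional ℂ F := by
    have e1 := Submodule.quotientEquivOfIsCompl W F hF
    have e2 := (obstr R₁ R₂ E).quotKerEquivRange
    have : FiniteDimensional ℂ (H ⧸ W) := Module.Finite.equiv e2.symm
    exact Module.Finite.equiv e1
  have hrange : LinearMap.range (B : H →ₗ[ℂ] H)
      = W.map (B : H →ₗ[ℂ] H) ⊔ F.map (B : H →ₗ[ℂ] H) := by
    rw [← Submodule.map_sup, hF.sup_eq_top, Submodule.map_top]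
  have hclosed : IsClosed ((LinearMap.range (B : H →ₗ[ℂ] H) : Submodule ℂ H) : Set H) := by
    rw [hrange]
    exact Submodule.isClosed_sup_finiteDimensional _ _ hBW
  have hker : LinearMap.ker (B : H →ₗ[ℂ] H) = ⊥ := hbot
  have horth : (LinearMap.range (B : H →ₗ[ℂ] H))ᗮ = ⊥ := by
    rw [← hker]
    exact ContinuousLinearMap.IsStarNormal.orthogonal_range hBn
  have htop : LinearMap.range (B : H →ₗ[ℂ] H) = ⊤ := by
    have : CompleteSpace (LinearMap.range (B : H →ₗ[ℂ] H)) := hclosed.completeSpace_coe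
    exact (Submodule.orthogonal_eq_bot_iff).1 horth
  rw [ContinuousLinearMap.isUnit_iff_bijective]
  exact ⟨LinearMap.ker_eq_bot.1 hker, LinearMap.range_eq_top.1 htop⟩

lemma not_ess {T : H →ₗ.[ℂ] H} {z : ℂ} {R : H →L[ℂ] H} (h : IsResolventAt T z R)
    (hR : GoodRes z R) (Δ : Set ℝ) (hΔopen : IsOpen Δ)
    (hE : FiniteDimensional ℂ ↥(⨆ μ ∈ Δ, eR z R ((μ : ℝ) : ℂ)))
    (hΔ : ∀ t ∈ Δ, IsUnit (1 - ((t : ℂ) - z) • R) ∨ eR z R (t : ℂ) ≠ ⊥)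
    (t : ℝ) (ht : t ∈ Δ) : (t : ℂ) ∉ essSpectrum T := by
  rintro ⟨hs, hno⟩
  apply hno
  have hspec : ∀ s : ℂ, s ∈ pSpectrum T ↔ ¬ IsUnit (1 - (s - z) • R) := fun s =>
    not_congr (mem_pResolventSet_iff h s)
  have hfin := finite_eig Δ hE
  set S := {μ : ℝ | μ ∈ Δ ∧ eR z R (μ : ℂ) ≠ ⊥} with hS
  refine ⟨⟨Complex.re ⁻¹' (Δ ∩ (S \ {t})ᶜ), ?_, ?_⟩, ?_, ?_⟩
  · refine IsOpen.mem_nhds (IsOpen.preimage Complex.continuous_re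
      (hΔopen.inter (hfin.subset Set.diff_subset).isClosed.isOpen_compl)) ?_
    simp [ht]
  · ext s
    constructor
    · rintro ⟨hs1, hs2, hs3⟩
      have him : s.im = 0 := by
        by_contra him
        exact (hspec s).1 hs1 (isUnit_of_im hR him)
      have hre : ((s.re : ℝ) : ℂ) = s := Complex.ext (by simp) (by simp [him])
      have hmem : s.re ∈ S := by
        refine ⟨hs2, ?_⟩
        rcases hΔ s.re hs2 with h' | h'
        · rw [hre] at h'
          exact absurd h' ((hspec s).1 hs1)
        · exact h'
      have : s.re = t := by
        by_contra hne
        exact hs3 ⟨hmem, hne⟩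
      rw [Set.mem_singleton_iff, ← hre, this]
    · rintro rfl
      refine ⟨hs, ?_⟩
      simp [ht]
  · rw [eigSpaceP_eq h]
    exact (hΔ t ht).resolve_left ((hspec _).1 hs)
  · rw [eigSpaceP_eq h]
    exact Submodule.finiteDimensional_of_le (S₂ := ⨆ μ ∈ Δ, eR z R ((μ : ℝ) : ℂ))
      (le_iSup₂_of_le (f := fun (μ : ℝ) (_ : μ ∈ Δ) => eR z R (μ : ℂ)) t ht le_rfl)

theorem stmt13 (T₁ T₂ : H →ₗ.[ℂ] H) (h₁ : IsSelfAdjoint T₁) (h₂ : IsSelfAdjoint T₂)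
    (lam0 : ℂ) (R₁ R₂ : H →L[ℂ] H)
    (hR₁ : IsResolventAt T₁ lam0 R₁) (hR₂ : IsResolventAt T₂ lam0 R₂)
    (n : ℕ)
    (hrank : Module.finrank ℂ ↥(LinearMap.range ((R₁ - R₂ : H →L[ℂ] H) : H →ₗ[ℂ] H)) = n)
    (hfin : FiniteDimensional ℂ ↥(LinearMap.range ((R₁ - R₂ : H →L[ℂ] H) : H →ₗ[ℂ] H)))
    (Δ : Set ℝ) (hΔopen : IsOpen Δ) (hΔconn : Δ.OrdConnected)
    (hess : ∀ t ∈ Δ, (t : ℂ) ∉ essSpectrum T₁)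
    (hfin₁ : FiniteDimensional ℂ (eigSpanP T₁ Δ)) :
    (∀ t ∈ Δ, (t : ℂ) ∉ essSpectrum T₂) ∧
      FiniteDimensional ℂ (eigSpanP T₂ Δ) ∧
      |(Module.finrank ℂ (eigSpanP T₁ Δ) : ℤ) - Module.finrank ℂ (eigSpanP T₂ Δ)| ≤ n := by

  have g₁ := goodRes h₁ hR₁
  have g₂ := goodRes h₂ hR₂
  have e₁ : eigSpanP T₁ Δ = ⨆ μ ∈ Δ, eR lam0 R₁ ((μ : ℝ) : ℂ) := by
    simp only [eigSpanP, eigSpaceP_eq hR₁]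
  have e₂ : eigSpanP T₂ Δ = ⨆ μ ∈ Δ, eR lam0 R₂ ((μ : ℝ) : ℂ) := by
    simp only [eigSpanP, eigSpaceP_eq hR₂]
  rw [e₁] at hfin₁
  have hΔ₁ : ∀ t ∈ Δ, IsUnit (1 - ((t : ℂ) - lam0) • R₁) ∨ eR lam0 R₁ (t : ℂ) ≠ ⊥ := by
    intro t ht
    by_contra hcon
    push Not at hcon
    refine hess t ht ⟨fun hmem => hcon.1 ((mem_pResolventSet_iff hR₁ _).1 hmem), ?_⟩
    rintro ⟨-, hne, -⟩
    rw [eigSpaceP_eq hR₁] at hne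
    exact hne hcon.2
  have hΔ₂ := fredholm g₁ g₂ Δ hΔopen hfin₁ hΔ₁ hfin
  obtain ⟨f₂, c₁⟩ := count g₁ g₂ Δ hΔopen hΔconn hfin₁ hΔ₁ hfin
  have hrange : LinearMap.range ((R₂ - R₁ : H →L[ℂ] H) : H →ₗ[ℂ] H)
      = LinearMap.range ((R₁ - R₂ : H →L[ℂ] H) : H →ₗ[ℂ] H) := by
    rw [← neg_sub R₁ R₂]
    exact LinearMap.range_neg _
  obtain ⟨-, c₂⟩ := count g₂ g₁ Δ hΔopen hΔconn f₂ hΔ₂ (by rw [hrange]; exact hfin)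
  rw [hrange, hrank] at c₂
  rw [hrank] at c₁
  refine ⟨not_ess hR₂ g₂ Δ hΔopen f₂ hΔ₂, ?_, ?_⟩
  · rw [e₂]; exact f₂
  · rw [e₁, e₂, abs_le]
    constructor <;> omega
end

section
/- Let J be an invertible Hermitian matrix on ℂᴺ with κ₊ positive and κ₋ negative eigenvalues, and let A be a diagonalizable J-selfadjoint matrix with all eigenvalues real. For any real numbers a < b with no eigenvalue of A equal to a or b, the Hermitian matrix H = (A - b)ᴴ J (A - a) satisfies: the number of negative eigenvalues of H equals κ₊(L_in) + κ₋(L_out), where L_in is the sum of eigenspaces of A for eigenvalues in (a,b), L_out is the sum of eigenspaces for eigenvalues outside [a,b], and κ₊, κ₋ denote the numbers of positive and negative squares of [x,y]=(Jx,y) on the respective subspace. -/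
open Matrix

/-- `A` is diagonalizable. -/
def Diagonalizable {N : ℕ} (A : Matrix (Fin N) (Fin N) ℂ) : Prop :=
  ∃ P D : Matrix (Fin N) (Fin N) ℂ, IsUnit P.det ∧ D.IsDiag ∧ A = P * D * P⁻¹

/-- The indefinite inner product `[x,y] = (Jx, y)` on `ℂᴺ`. -/
noncomputable def Jform {N : ℕ} (J : Matrix (Fin N) (Fin N) ℂ) (x y : Fin N → ℂ) : ℂ :=
  star (J *ᵥ x) ⬝ᵥ y

/-- Number of positive squares of `[·,·]` on the subspace `L`. -/
noncomputable def posSquares {N : ℕ} (J : Matrix (Fin N) (Fin N) ℂ)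
    (L : Submodule ℂ (Fin N → ℂ)) : ℕ :=
  sSup {d : ℕ | ∃ W : Submodule ℂ (Fin N → ℂ), W ≤ L ∧ Module.finrank ℂ W = d ∧
    ∀ x ∈ W, x ≠ 0 → 0 < (Jform J x x).re}

/-- Number of negative squares of `[·,·]` on the subspace `L`. -/
noncomputable def negSquares {N : ℕ} (J : Matrix (Fin N) (Fin N) ℂ)
    (L : Submodule ℂ (Fin N → ℂ)) : ℕ :=
  sSup {d : ℕ | ∃ W : Submodule ℂ (Fin N → ℂ), W ≤ L ∧ Module.finrank ℂ W = d ∧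
    ∀ x ∈ W, x ≠ 0 → (Jform J x x).re < 0}

/-- Sum of the eigenspaces of `A` for (real) eigenvalues in `Δ`. -/
noncomputable def eigSpan {N : ℕ} (A : Matrix (Fin N) (Fin N) ℂ) (Δ : Set ℝ) :
    Submodule ℂ (Fin N → ℂ) :=
  ⨆ μ ∈ Δ, Module.End.eigenspace (Matrix.toLin' A) (μ : ℂ)

lemma aux_Jform_basis {N : ℕ} (M : Matrix (Fin N) (Fin N) ℂ)
    (e : Module.Basis (Fin N) ℂ (Fin N → ℂ)) (γ : Fin N → ℝ)
    (h : ∀ i j, Jform M (e i) (e j) = if i = j then (γ i : ℂ) else 0) (x : Fin N → ℂ) :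
    (Jform M x x).re = ∑ i, γ i * Complex.normSq (e.repr x i) := by
  have hx : Jform M x x = ∑ i, ∑ j, star (e.repr x i) * (e.repr x j) * Jform M (e i) (e j) := by
    conv_lhs => rw [← e.sum_repr x]
    simp only [Jform, Matrix.mulVec_sum, star_sum, sum_dotProduct, dotProduct_sum,
      Matrix.mulVec_smul, star_smul, smul_dotProduct, dotProduct_smul, smul_eq_mul]
    simp only [Finset.mul_sum]
    rw [Finset.sum_comm]
    refine Finset.sum_congr rfl fun i _ => Finset.sum_congr rfl fun j _ => ?_
    ring
  rw [hx]
  simp only [h, mul_ite, mul_zero, Finset.sum_ite_eq, Finset.mem_univ, if_true]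
  rw [Complex.re_sum]
  refine Finset.sum_congr rfl fun i _ => ?_
  simp [Complex.normSq_apply]
  ring

lemma aux_finrank {N : ℕ} (e : Module.Basis (Fin N) ℂ (Fin N → ℂ)) (T : Finset (Fin N)) :
    Module.finrank ℂ (Submodule.span ℂ (e '' (T : Set (Fin N)))) = T.card := by
  have := finrank_span_eq_card (R := ℂ) (b := fun i : T => e i)
    (e.linearIndependent.comp _ Subtype.val_injective)
  rw [Fintype.card_coe] at this
  rw [← this]
  have h2 : e '' (T : Set (Fin N)) = Set.range (fun i : T => e i) := by
    ext y; simp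
  rw [h2]

lemma aux_mem {N : ℕ} (e : Module.Basis (Fin N) ℂ (Fin N → ℂ)) (T : Set (Fin N))
    (x : Fin N → ℂ) :
    x ∈ Submodule.span ℂ (e '' T) ↔ ∀ i, i ∉ T → e.repr x i = 0 := by
  rw [e.mem_span_image, Finsupp.support_subset_iff]

open Classical in
lemma aux_neg {N : ℕ} (M : Matrix (Fin N) (Fin N) ℂ)
    (e : Module.Basis (Fin N) ℂ (Fin N → ℂ)) (γ : Fin N → ℝ)
    (h : ∀ i j, Jform M (e i) (e j) = if i = j then (γ i : ℂ) else 0) (S : Set (Fin N)) :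
    negSquares M (Submodule.span ℂ (e '' S)) =
      (Finset.univ.filter fun i => i ∈ S ∧ γ i < 0).card := by
  set T := Finset.univ.filter fun i => i ∈ S ∧ γ i < 0 with hT
  refine IsGreatest.csSup_eq ⟨⟨Submodule.span ℂ (e '' (T : Set (Fin N))), ?_, aux_finrank e T, ?_⟩,
    ?_⟩
  · apply Submodule.span_mono
    apply Set.image_mono
    intro i hi
    simp [hT] at hi
    exact hi.1
  · intro x hx hx0
    rw [aux_mem] at hx
    rw [aux_Jform_basis M e γ h]
    have hne : ∃ i, e.repr x i ≠ 0 := by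
      by_contra! hc
      apply hx0
      apply e.repr.injective
      ext i
      simp [hc i]
    obtain ⟨i, hi⟩ := hne
    have key : ∀ j, e.repr x j ≠ 0 → γ j < 0 := by
      intro j hj
      have : j ∈ (T : Set (Fin N)) := by
        by_contra hc
        exact hj (hx j hc)
      simp [hT] at this
      exact this.2
    apply Finset.sum_neg'
    · intro j _
      by_cases hj : e.repr x j = 0
      · simp [hj]
      · exact mul_nonpos_of_nonpos_of_nonneg (key j hj).le (Complex.normSq_nonneg _)
    · exact ⟨i, Finset.mem_univ _, mul_neg_of_neg_of_pos (key i hi) (Complex.normSq_pos.2 hi)⟩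
  · rintro d ⟨W, hWL, rfl, hW⟩
    have hdis : Disjoint W (Submodule.span ℂ (e '' ((Tᶜ : Finset (Fin N)) : Set (Fin N)))) := by
      rw [Submodule.disjoint_def]
      intro x hxW hx
      by_contra hx0
      have h1 := hW x hxW hx0
      have h2 := (aux_mem e _ _).1 (hWL hxW)
      rw [aux_mem] at hx
      rw [aux_Jform_basis M e γ h] at h1
      refine absurd h1 (not_lt.2 (Finset.sum_nonneg fun i _ => ?_))
      by_cases hi : e.repr x i = 0
      · simp [hi]
      · have hS : i ∈ S := by
          by_contra hc
          exact hi (h2 i hc)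
        have hi' : i ∉ T := by
          intro hc
          apply hi
          apply hx
          simpa using hc
        simp [hT, hS] at hi'
        exact mul_nonneg hi' (Complex.normSq_nonneg _)
    have := Submodule.finrank_add_finrank_le_of_disjoint hdis
    rw [aux_finrank, Finset.card_compl] at this
    have hc := Finset.card_le_univ T
    simp at this hc
    omega

lemma aux_Jform_neg {N : ℕ} (M : Matrix (Fin N) (Fin N) ℂ) (x y : Fin N → ℂ) :
    Jform (-M) x y = - Jform M x y := by
  simp [Jform, Matrix.neg_mulVec]

lemma aux_pos_eq {N : ℕ} (M : Matrix (Fin N) (Fin N) ℂ) (L : Submodule ℂ (Fin N → ℂ)) :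
    posSquares M L = negSquares (-M) L := by
  simp [posSquares, negSquares, aux_Jform_neg]

open Classical in
lemma aux_pos {N : ℕ} (M : Matrix (Fin N) (Fin N) ℂ)
    (e : Module.Basis (Fin N) ℂ (Fin N → ℂ)) (γ : Fin N → ℝ)
    (h : ∀ i j, Jform M (e i) (e j) = if i = j then (γ i : ℂ) else 0) (S : Set (Fin N)) :
    posSquares M (Submodule.span ℂ (e '' S)) =
      (Finset.univ.filter fun i => i ∈ S ∧ 0 < γ i).card := by
  rw [aux_pos_eq, aux_neg (-M) e (fun i => - γ i)]
  · simp
  · intro i j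
    rw [aux_Jform_neg, h]
    split_ifs <;> simp

lemma aux_eigSpan {N : ℕ} (A : Matrix (Fin N) (Fin N) ℂ)
    (e : Module.Basis (Fin N) ℂ (Fin N → ℂ)) (μ : Fin N → ℝ)
    (h : ∀ i, A *ᵥ e i = (μ i : ℂ) • e i) (Δ : Set ℝ) :
    eigSpan A Δ = Submodule.span ℂ (e '' {i | μ i ∈ Δ}) := by
  apply le_antisymm
  · refine iSup₂_le fun t ht x hx => ?_
    rw [Module.End.mem_eigenspace_iff, Matrix.toLin'_apply] at hx
    rw [aux_mem]
    intro i hi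
    have h1 : A *ᵥ x = ∑ j, ((μ j : ℂ) * e.repr x j) • e j := by
      conv_lhs => rw [← e.sum_repr x]
      simp only [Matrix.mulVec_sum, Matrix.mulVec_smul, h, smul_smul, mul_comm]
    have h2 := congrArg (fun y => e.repr y i) (h1.symm.trans hx)
    simp only [e.repr_sum_self, map_smul, Finsupp.smul_apply, smul_eq_mul] at h2
    by_contra hne
    have h3 := mul_right_cancel₀ hne h2
    have h4 : μ i = t := by exact_mod_cast h3
    exact hi (by simpa [h4] using ht)
  · rw [Submodule.span_le]
    rintro _ ⟨i, hi, rfl⟩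
    have h1 : e i ∈ Module.End.eigenspace (Matrix.toLin' A) (μ i : ℂ) := by
      rw [Module.End.mem_eigenspace_iff, Matrix.toLin'_apply, h]
    exact (le_iSup₂_of_le (f := fun (μ : ℝ) (_ : μ ∈ Δ) =>
      Module.End.eigenspace (Matrix.toLin' A) (μ : ℂ)) (μ i) hi le_rfl) h1

lemma aux_orth {N : ℕ} (M : Matrix (Fin N) (Fin N) ℂ)
    (v : OrthonormalBasis (Fin N) ℂ (EuclideanSpace ℂ (Fin N))) (c : Fin N → ℝ)
    (h : ∀ i, M *ᵥ (v i).ofLp = (c i : ℂ) • (v i).ofLp) (i j : Fin N) :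
    Jform M (v i).ofLp (v j).ofLp = if i = j then (c i : ℂ) else 0 := by
  have h1 := orthonormal_iff_ite.1 v.orthonormal i j
  rw [EuclideanSpace.inner_eq_star_dotProduct] at h1
  rw [Jform, h, star_smul, smul_dotProduct, dotProduct_comm, h1]
  simp

lemma aux_joint {N : ℕ} (D G : Module.End ℂ (EuclideanSpace ℂ (Fin N)))
    (sD : D.IsSymmetric) (sG : G.IsSymmetric) (hC : Commute D G) :
    ∃ (v : OrthonormalBasis (Fin N) ℂ (EuclideanSpace ℂ (Fin N))) (idx : Fin N → ℂ × ℂ),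
      ∀ i, v i ∈ Module.End.eigenspace D (idx i).2 ∧ v i ∈ Module.End.eigenspace G (idx i).1 := by
  classical
  have hint := LinearMap.IsSymmetric.directSum_isInternal_of_commute sD sG hC
  have hfam := LinearMap.IsSymmetric.orthogonalFamily_eigenspace_inf_eigenspace sD sG
  have hn : Module.finrank ℂ (EuclideanSpace ℂ (Fin N)) = N := by simp
  generalize hV : (fun i : ℂ × ℂ => Module.End.eigenspace D i.2 ⊓ Module.End.eigenspace G i.1) = V
    at hint
  have hfam : OrthogonalFamily ℂ (fun i => V i) fun i => (V i).subtypeₗᵢ := by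
    subst hV
    exact hfam
  have hfin : {i | V i ≠ ⊥}.Finite :=
    WellFoundedGT.finite_ne_bot_of_iSupIndep hint.submodule_iSupIndep
  have hint' : DirectSum.IsInternal (fun i : {i // V i ≠ ⊥} => V i) :=
    DirectSum.isInternal_ne_bot_iff.2 hint
  have hfam' : OrthogonalFamily ℂ (fun i : {i // V i ≠ ⊥} => V i) fun i => (V i).subtypeₗᵢ :=
    hfam.comp Subtype.val_injective
  letI : Fintype {i // V i ≠ ⊥} := hfin.fintype
  refine ⟨hint'.subordinateOrthonormalBasis hn hfam',
    fun i => (hint'.subordinateOrthonormalBasisIndex hn i hfam').1, fun i => ?_⟩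
  have h := hint'.subordinateOrthonormalBasis_subordinate hn i hfam'
  beta_reduce
  generalize (hint'.subordinateOrthonormalBasisIndex hn i hfam').1 = k at h ⊢
  subst hV
  exact h

/-- Simultaneous diagonalization of the pair `(J, A)`. -/
lemma aux_exists {N : ℕ} (J A : Matrix (Fin N) (Fin N) ℂ) (hJ : J.IsHermitian)
    (hA : J * A = Aᴴ * J) (hd : Diagonalizable A)
    (hr : spectrum ℂ A ⊆ Set.range (Complex.ofReal)) :
    ∃ (e : Module.Basis (Fin N) ℂ (Fin N → ℂ)) (μ γ : Fin N → ℝ),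
      (∀ i, A *ᵥ e i = (μ i : ℂ) • e i) ∧
      ∀ i j, Jform J (e i) (e j) = if i = j then (γ i : ℂ) else 0 := by
  obtain ⟨P, D, hP, hD, rfl⟩ := hd
  have hPi : P⁻¹ * P = 1 := Matrix.nonsing_inv_mul P hP
  have hPi' : P * P⁻¹ = 1 := Matrix.mul_nonsing_inv P hP
  have hAP : P * D * P⁻¹ * P = P * D := by rw [Matrix.mul_assoc, hPi, Matrix.mul_one]
  have hDdiag : Matrix.diagonal (fun i => D i i) = D := hD.diagonal_diag
  have hDreal : ∀ i, star (D i i) = D i i := by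
    intro i
    have h1 : D i i ∈ spectrum ℂ (P * D * P⁻¹) := by
      rw [← Matrix.spectrum_toLin', ← Module.End.hasEigenvalue_iff_mem_spectrum]
      refine Module.End.hasEigenvalue_of_hasEigenvector (x := P *ᵥ Pi.single i 1)
        ⟨?_, ?_⟩
      · rw [Module.End.mem_eigenspace_iff, Matrix.toLin'_apply, Matrix.mulVec_mulVec, hAP,
          ← Matrix.mulVec_mulVec, ← Matrix.mulVec_smul]
        congr 1
        rw [← hDdiag]
        ext j
        simp [Matrix.mulVec_diagonal, Pi.single_apply]
        split_ifs with hji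
        · rw [hji]
        · rfl
      · intro h0
        have := congrArg (fun y => P⁻¹ *ᵥ y) h0
        simp only [Matrix.mulVec_mulVec, hPi, Matrix.one_mulVec, Matrix.mulVec_zero] at this
        have := congrFun this i
        simp at this
    obtain ⟨r, hr'⟩ := hr h1
    rw [← hr']
    exact Complex.conj_ofReal r
  have hDH : D.IsHermitian := by
    rw [← hDdiag]
    exact Matrix.isHermitian_diagonal_of_self_adjoint _ (funext hDreal)
  set G := Pᴴ * J * P with hG
  have hGH : G.IsHermitian := Matrix.isHermitian_conjTranspose_mul_mul P hJ
  have hcomm : D * G = G * D := by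
    have h1 : G * D = Pᴴ * (J * (P * D * P⁻¹)) * P := by
      simp only [hG, Matrix.mul_assoc, hPi, Matrix.mul_one]
    rw [h1, hA]
    have h2 : Pᴴ * (P * D * P⁻¹)ᴴ = D * Pᴴ := by
      rw [← Matrix.conjTranspose_mul, hAP, Matrix.conjTranspose_mul, hDH.eq]
    rw [← Matrix.mul_assoc Pᴴ, h2, hG]
    simp only [Matrix.mul_assoc]
  have sD := Matrix.isSymmetric_toEuclideanLin_iff.mpr hDH
  have sG := Matrix.isSymmetric_toEuclideanLin_iff.mpr hGH
  have hC : Commute (Matrix.toEuclideanLin D) (Matrix.toEuclideanLin G) := by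
    apply LinearMap.ext
    intro x
    simp only [Module.End.mul_apply, Matrix.toLpLin_apply, Matrix.mulVec_mulVec, hcomm]
  obtain ⟨v, idx, hv⟩ := aux_joint _ _ sD sG hC
  have hreal : ∀ (M : Matrix (Fin N) (Fin N) ℂ), (Matrix.toEuclideanLin M).IsSymmetric →
      ∀ i c, v i ∈ Module.End.eigenspace (Matrix.toEuclideanLin M) c →
      M *ᵥ (v i).ofLp = (c.re : ℂ) • (v i).ofLp := by
    intro M sM i c hc
    have h1 : (starRingEnd ℂ) c = c := sM.conj_eigenvalue_eq_self
      (Module.End.hasEigenvalue_of_hasEigenvector ⟨hc, v.orthonormal.ne_zero i⟩)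
    rw [Complex.conj_eq_iff_re.1 h1]
    rw [Module.End.mem_eigenspace_iff, Matrix.toLpLin_apply] at hc
    exact congrArg WithLp.ofLp hc
  let e := (v.toBasis.map (WithLp.linearEquiv 2 ℂ (Fin N → ℂ))).map
    (Matrix.toLin'OfInv hPi hPi')
  have he : ∀ i, e i = P *ᵥ (v i).ofLp := by
    intro i
    simp [e]
    rfl
  refine ⟨e, fun i => (idx i).2.re, fun i => (idx i).1.re, ?_, ?_⟩
  · intro i
    rw [he, Matrix.mulVec_mulVec, hAP, ← Matrix.mulVec_mulVec, hreal D sD i _ (hv i).1,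
      Matrix.mulVec_smul]
  · intro i j
    rw [← aux_orth G v (fun i => (idx i).1.re) (fun i => hreal G sG i _ (hv i).2) i j, he, he]
    simp only [Jform, hG, ← Matrix.mulVec_mulVec]
    rw [Matrix.star_mulVec Pᴴ, Matrix.conjTranspose_conjTranspose, Matrix.dotProduct_mulVec]

theorem stmt14 {N : ℕ} (J A : Matrix (Fin N) (Fin N) ℂ)
    (hJinv : IsUnit J.det) (hJ : J.IsHermitian)
    (hA : J * A = Aᴴ * J) (hd : Diagonalizable A)
    (hr : spectrum ℂ A ⊆ Set.range (Complex.ofReal))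
    (a b : ℝ) (hab : a < b)
    (ha : (a : ℂ) ∉ spectrum ℂ A) (hb : (b : ℂ) ∉ spectrum ℂ A) :
    ∃ hH : ((A - (b : ℂ) • 1)ᴴ * J * (A - (a : ℂ) • 1)).IsHermitian,
      (Finset.univ.filter fun i => hH.eigenvalues i < 0).card =
        posSquares J (eigSpan A (Set.Ioo a b)) +
          negSquares J (eigSpan A {t : ℝ | t ∉ Set.Icc a b}) := by
  have hJA : (A - (b : ℂ) • 1)ᴴ * J * (A - (a : ℂ) • 1) =
      J * ((A - (b : ℂ) • 1) * (A - (a : ℂ) • 1)) := by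
    have : (A - (b : ℂ) • 1)ᴴ * J = J * (A - (b : ℂ) • 1) := by
      simp [sub_mul, mul_sub, hA]
    rw [this, Matrix.mul_assoc]
  have hJA' : (A - (a : ℂ) • 1)ᴴ * J * (A - (b : ℂ) • 1) =
      J * ((A - (b : ℂ) • 1) * (A - (a : ℂ) • 1)) := by
    have : (A - (a : ℂ) • 1)ᴴ * J = J * (A - (a : ℂ) • 1) := by
      simp [sub_mul, mul_sub, hA]
    rw [this, Matrix.mul_assoc]
    congr 1
    simp only [sub_mul, mul_sub, smul_mul_assoc, mul_smul_comm, one_mul, mul_one, smul_sub]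
    rw [smul_comm (a : ℂ) (b : ℂ)]
    abel
  have hH : ((A - (b : ℂ) • 1)ᴴ * J * (A - (a : ℂ) • 1)).IsHermitian := by
    rw [Matrix.IsHermitian, hJA, ← hJA', Matrix.conjTranspose_mul, Matrix.conjTranspose_mul,
      Matrix.conjTranspose_conjTranspose, hJ.eq, ← Matrix.mul_assoc, hJA, hJA']
  refine ⟨hH, ?_⟩
  obtain ⟨e, μ, γ, he, hγ⟩ := aux_exists J A hJ hA hd hr
  classical
  rw [aux_eigSpan A e μ he, aux_eigSpan A e μ he, aux_pos J e γ hγ, aux_neg J e γ hγ]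
  set H := (A - (b : ℂ) • 1)ᴴ * J * (A - (a : ℂ) • 1) with hHdef
  have h1 := aux_neg H (hH.eigenvectorBasis.toBasis.map (WithLp.linearEquiv 2 ℂ (Fin N → ℂ)))
    hH.eigenvalues (by
      intro i j
      simpa using aux_orth H hH.eigenvectorBasis hH.eigenvalues
        (fun i => by
          rw [hH.mulVec_eigenvectorBasis]
          ext k
          simp) i j) Set.univ
  have h2 := aux_neg H e (fun i => (μ i - b) * (μ i - a) * γ i) (by
      intro i j
      have hsub : ∀ t : ℝ, ∀ k, (A - (t : ℂ) • 1) *ᵥ e k = ((μ k - t : ℝ) : ℂ) • e k := by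
        intro t k
        rw [Matrix.sub_mulVec, he, Matrix.smul_mulVec, Matrix.one_mulVec, ← sub_smul]
        push_cast
        rfl
      have : H *ᵥ e i = (((μ i - b) * (μ i - a) : ℝ) : ℂ) • (J *ᵥ e i) := by
        rw [hJA, ← Matrix.mulVec_mulVec, ← Matrix.mulVec_mulVec, hsub, Matrix.mulVec_smul, hsub,
          Matrix.mulVec_smul, Matrix.mulVec_smul, smul_smul]
        push_cast
        ring_nf
      have h3 : Jform H (e i) (e j) = (((μ i - b) * (μ i - a) : ℝ) : ℂ) * Jform J (e i) (e j) := by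
        rw [Jform, this, star_smul, smul_dotProduct, Jform]
        simp
      rw [h3, hγ]
      split_ifs <;> simp) Set.univ
  have htop : ∀ f : Module.Basis (Fin N) ℂ (Fin N → ℂ),
      Submodule.span ℂ (f '' Set.univ) = ⊤ := fun f => by
    rw [Set.image_univ, f.span_eq]
  rw [htop] at h1 h2
  rw [h1] at h2
  simp only [Set.mem_univ, true_and] at h2
  rw [h2, ← Finset.card_union_of_disjoint]
  · congr 1
    ext i
    simp only [Finset.mem_filter, Finset.mem_univ, true_and, Finset.mem_union, Set.mem_ofPred_eq,
      Set.mem_Ioo, Set.mem_Icc, not_and_or, not_le]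
    rcases lt_trichotomy (μ i) a with h | h | h
    · have hp : 0 < (μ i - b) * (μ i - a) := mul_pos_of_neg_of_neg (by linarith) (by linarith)
      rw [mul_neg_iff]
      constructor
      · rintro (h' | h')
        · exact Or.inr ⟨Or.inl h, h'.2⟩
        · linarith [h'.1]
      · rintro (h' | h')
        · linarith [h'.1.1]
        · exact Or.inl ⟨hp, h'.2⟩
    · simp [h, hab.le, not_lt.2 hab.le]
    · rcases lt_trichotomy (μ i) b with h' | h' | h'
      · have hp : (μ i - b) * (μ i - a) < 0 := mul_neg_of_neg_of_pos (by linarith) (by linarith)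
        simp [h, h', h.le, not_lt.2 h.le, not_lt.2 h'.le, mul_neg_iff, hp, not_lt.2 hp.le]
      · simp [h', hab.le, not_lt.2 hab.le]
      · have hp : 0 < (μ i - b) * (μ i - a) := mul_pos (by linarith) (by linarith)
        simp [h, h', not_lt.2 h'.le, mul_neg_iff, hp, not_lt.2 hp.le]
  · rw [Finset.disjoint_left]
    intro i hi hi'
    simp only [Finset.mem_filter] at hi hi'
    linarith [hi.2.2, hi'.2.2]
end

section
/- Let (P, [·,·]) be a finite-dimensional space with nondegenerate Hermitian form of signature (κ₊, κ₋), realized as ℂᴺ with [x,y] = (Jx,y) for an invertible Hermitian matrix J. Let A₁, A₂ be diagonalizable J-selfadjoint matrices with real spectra such that {x : A₁x = A₂x} has codimension n. Then for every open real interval Δ, |eig(A₁, Δ) - eig(A₂, Δ)| ≤ n + 2·min(κ₊, κ₋), where eig(Aⱼ, Δ) is the total multiplicity of eigenvalues of Aⱼ in Δ. -/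
open Matrix

/-- Total multiplicity of the eigenvalues of `A` in the real set `Δ`. -/
noncomputable def eigCount {N : ℕ} (A : Matrix (Fin N) (Fin N) ℂ) (Δ : Set ℝ) : ℕ :=
  Module.finrank ℂ ↥(⨆ μ ∈ Δ, Module.End.eigenspace (Matrix.toLin' A) (μ : ℂ))

/-- Real diagonal matrix as a complex matrix. -/
noncomputable def rdiag {N : ℕ} (d : Fin N → ℝ) : Matrix (Fin N) (Fin N) ℂ :=
  Matrix.diagonal (fun i => (d i : ℂ))

lemma exists_real_diag {N : ℕ} (A : Matrix (Fin N) (Fin N) ℂ) (hd : Diagonalizable A)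
    (hr : spectrum ℂ A ⊆ Set.range (Complex.ofReal)) :
    ∃ (P R : Matrix (Fin N) (Fin N) ℂ) (d : Fin N → ℝ), P * R = 1 ∧ R * P = 1 ∧
      A = P * rdiag d * R := by
  obtain ⟨P, D, hP, hD, hA⟩ := hd
  have h1 : P * P⁻¹ = 1 := Matrix.mul_nonsing_inv P hP
  have h2 : P⁻¹ * P = 1 := Matrix.nonsing_inv_mul P hP
  have key : ∀ i, ∃ r : ℝ, (r : ℂ) = D i i := by
    intro i
    have : D i i ∈ spectrum ℂ A := by
      rw [← Matrix.spectrum_toLin']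
      apply Module.End.HasEigenvalue.mem_spectrum
      apply Module.End.hasEigenvalue_of_hasEigenvector (x := P *ᵥ Pi.single i 1)
      refine ⟨?_, ?_⟩
      · rw [Module.End.mem_eigenspace_iff, Matrix.toLin'_apply, hA, Matrix.mulVec_mulVec,
          Matrix.mul_assoc, h2, Matrix.mul_one, ← Matrix.mulVec_mulVec, ← Matrix.mulVec_smul]
        congr 1
        rw [← hD.diagonal_diag]
        ext j
        simp [Matrix.mulVec_diagonal, Pi.single_apply]
        split_ifs with h
        · rw [h]
        · rfl
      · intro h
        have := congrArg (fun v => P⁻¹ *ᵥ v) h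
        simp only [Matrix.mulVec_mulVec, h2, Matrix.one_mulVec, Matrix.mulVec_zero] at this
        have := congrFun this i
        simp at this
    exact hr this
  choose d hd using key
  refine ⟨P, P⁻¹, d, h1, h2, ?_⟩
  have : rdiag d = D := by
    rw [← hD.diagonal_diag]
    unfold rdiag
    congr 1
    ext i
    simp [hd]
  rw [this, hA]

lemma eigCount_eq {N : ℕ} (A P R : Matrix (Fin N) (Fin N) ℂ) (d : Fin N → ℝ)
    (h1 : P * R = 1) (h2 : R * P = 1) (hA : A = P * rdiag d * R) (Δ : Set ℝ) :
    eigCount A Δ = Nat.card {i // d i ∈ Δ} := by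
  classical
  have hli : LinearIndependent ℂ (fun i : {i // d i ∈ Δ} => P *ᵥ Pi.single i.1 (1:ℂ)) := by
    have hb : LinearIndependent ℂ (fun i : {i // d i ∈ Δ} => (Pi.single i.1 (1:ℂ) : Fin N → ℂ)) :=
      (Pi.linearIndependent_single_one (Fin N) ℂ).comp _ Subtype.val_injective
    have := hb.map' (Matrix.toLin' P) (by
      rw [LinearMap.ker_eq_bot']
      intro m hm
      have := congrArg (fun v => R *ᵥ v) hm
      simpa [Matrix.toLin'_apply, Matrix.mulVec_mulVec, h2] using this)
    exact this
  have hs : (⨆ μ ∈ Δ, Module.End.eigenspace (Matrix.toLin' A) (μ : ℂ)) =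
      Submodule.span ℂ (Set.range (fun i : {i // d i ∈ Δ} => P *ᵥ Pi.single i.1 (1:ℂ))) := by
    apply le_antisymm
    · refine iSup₂_le fun μ hμ x hx => ?_
      rw [Module.End.mem_eigenspace_iff, Matrix.toLin'_apply, hA] at hx
      have hy : ∀ i, (d i : ℂ) * (R *ᵥ x) i = μ * (R *ᵥ x) i := by
        intro i
        have := congrFun (congrArg (fun v => R *ᵥ v) hx) i
        simp only [Matrix.mulVec_mulVec, Matrix.mulVec_smul, ← Matrix.mul_assoc, h2,
          Matrix.one_mul] at this
        rw [← Matrix.mulVec_mulVec] at this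
        simpa [rdiag, Matrix.mulVec_diagonal] using this
      have hx' : x = ∑ i, (R *ᵥ x) i • (P *ᵥ Pi.single i (1:ℂ)) := by
        have : x = P *ᵥ (R *ᵥ x) := by simp [Matrix.mulVec_mulVec, h1]
        conv_lhs => rw [this]
        conv_lhs => rw [pi_eq_sum_univ' (R *ᵥ x)]
        rw [Matrix.mulVec_sum]
        refine Finset.sum_congr rfl fun i _ => ?_
        rw [Matrix.mulVec_smul]
      rw [hx']
      refine Submodule.sum_mem _ fun i _ => ?_
      by_cases h0 : (R *ᵥ x) i = 0
      · simp [h0]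
      · have : d i = μ := by exact_mod_cast mul_right_cancel₀ h0 (hy i)
        exact Submodule.smul_mem _ _ (Submodule.subset_span ⟨⟨i, this ▸ hμ⟩, rfl⟩)
    · rw [Submodule.span_le]
      rintro _ ⟨i, rfl⟩
      refine Submodule.mem_iSup_of_mem (d i.1) (Submodule.mem_iSup_of_mem i.2 ?_)
      rw [Module.End.mem_eigenspace_iff, Matrix.toLin'_apply, hA, Matrix.mulVec_mulVec,
          Matrix.mul_assoc, h2, Matrix.mul_one, ← Matrix.mulVec_mulVec, ← Matrix.mulVec_smul]
      congr 1
      ext j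
      simp only [rdiag, Matrix.mulVec_diagonal, Pi.single_apply, Pi.smul_apply, smul_eq_mul]
      split_ifs with h
      · rw [h]
      · simp
  rw [eigCount, hs, finrank_span_eq_card hli, Nat.card_eq_fintype_card]

/-- `J`-selfadjointness passes to functions of `A`. -/
lemma func_selfadj {N : ℕ} (J A P R : Matrix (Fin N) (Fin N) ℂ) (d : Fin N → ℝ)
    (h1 : P * R = 1) (h2 : R * P = 1) (hA : A = P * rdiag d * R) (hJA : J * A = Aᴴ * J)
    (s : ℝ → ℝ) :
    J * (P * rdiag (s ∘ d) * R) = (P * rdiag (s ∘ d) * R)ᴴ * J := by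
  have hherm : ∀ e : Fin N → ℝ, (rdiag e)ᴴ = rdiag e := by
    intro e
    simp only [rdiag, Matrix.diagonal_conjTranspose]
    congr 1
    ext i
    simp
  have h1' : Rᴴ * Pᴴ = 1 := by rw [← Matrix.conjTranspose_mul, h1, Matrix.conjTranspose_one]
  have h2' : Pᴴ * Rᴴ = 1 := by rw [← Matrix.conjTranspose_mul, h2, Matrix.conjTranspose_one]
  set G := Pᴴ * J * P with hG
  have hGd : G * rdiag d = rdiag d * G := by
    have h := congrArg (fun X => Pᴴ * X * P) hJA
    simp only [hA, Matrix.conjTranspose_mul, hherm] at h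
    calc G * rdiag d = Pᴴ * (J * (P * rdiag d * R)) * P := by
            simp only [hG, Matrix.mul_assoc, h2, Matrix.mul_one]
      _ = _ := h
      _ = (Pᴴ * Rᴴ) * (rdiag d * G) := by simp only [hG, Matrix.mul_assoc]
      _ = _ := by rw [h2', Matrix.one_mul]
  have hGs : G * rdiag (s ∘ d) = rdiag (s ∘ d) * G := by
    ext i j
    have h := congrFun (congrFun hGd i) j
    simp only [rdiag, Matrix.mul_diagonal, Matrix.diagonal_mul] at h ⊢
    by_cases h0 : G i j = 0
    · simp [h0]
    · have : d j = d i := by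
        rw [mul_comm] at h
        exact_mod_cast mul_right_cancel₀ h0 h
      simp [this, mul_comm]
  have hJ : J = Rᴴ * G * R := by
    calc J = (Rᴴ * Pᴴ) * J * (P * R) := by rw [h1, h1']; simp
      _ = _ := by simp only [hG, Matrix.mul_assoc]
  calc J * (P * rdiag (s ∘ d) * R) = Rᴴ * (G * ((R * P) * (rdiag (s ∘ d) * R))) := by
        rw [hJ]; simp only [Matrix.mul_assoc]
    _ = Rᴴ * (G * rdiag (s ∘ d)) * R := by rw [h2]; simp only [Matrix.mul_assoc, Matrix.one_mul]
    _ = Rᴴ * (rdiag (s ∘ d) * ((Pᴴ * Rᴴ) * G)) * R := by rw [hGs, h2', Matrix.one_mul]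
    _ = _ := by
      conv_rhs => rw [hJ]
      simp only [Matrix.conjTranspose_mul, hherm, Matrix.mul_assoc]

lemma form_eq {N : ℕ} (J A P R : Matrix (Fin N) (Fin N) ℂ) (d : Fin N → ℝ)
    (h1 : P * R = 1) (h2 : R * P = 1) (hA : A = P * rdiag d * R) (hJA : J * A = Aᴴ * J)
    (s : ℝ → ℝ) (ε a b : ℝ) (x : Fin N → ℂ)
    (hx : ∀ i, (R *ᵥ x) i ≠ 0 → s (d i) * s (d i) = ε * ((d i - a) * (d i - b))) :
    star ((P * rdiag (s ∘ d) * R) *ᵥ x) ⬝ᵥ (J *ᵥ ((P * rdiag (s ∘ d) * R) *ᵥ x)) =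
      ε * (star (A *ᵥ x) ⬝ᵥ (J *ᵥ (A *ᵥ x)) - (a + b) * (star x ⬝ᵥ (J *ᵥ (A *ᵥ x)))
        + a * b * (star x ⬝ᵥ (J *ᵥ x))) := by
  have mv : ∀ (B : Matrix (Fin N) (Fin N) ℂ), J * B = Bᴴ * J →
      star (B *ᵥ x) ⬝ᵥ (J *ᵥ (B *ᵥ x)) = star x ⬝ᵥ (J *ᵥ (B *ᵥ (B *ᵥ x))) := by
    intro B hB
    rw [Matrix.star_mulVec, ← Matrix.dotProduct_mulVec, Matrix.mulVec_mulVec, ← hB,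
      ← Matrix.mulVec_mulVec]
  rw [mv _ (func_selfadj J A P R d h1 h2 hA hJA s), mv A hJA]
  have sq : ∀ e f : Fin N → ℝ, (P * rdiag e * R) *ᵥ ((P * rdiag f * R) *ᵥ x) =
      P *ᵥ (fun i => (e i : ℂ) * f i * (R *ᵥ x) i) := by
    intro e f
    have : (P * rdiag e * R) * (P * rdiag f * R) = P * (rdiag e * rdiag f) * R := by
      calc _ = P * rdiag e * (R * P) * (rdiag f * R) := by simp only [Matrix.mul_assoc]
        _ = _ := by rw [h2]; simp only [Matrix.mul_assoc, Matrix.one_mul]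
    rw [Matrix.mulVec_mulVec, this, Matrix.mul_assoc, ← Matrix.mulVec_mulVec,
      ← Matrix.mulVec_mulVec]
    congr 1
    ext i
    simp [rdiag, Matrix.mulVec_diagonal]
  have e1 : A *ᵥ x = P *ᵥ (fun i => (d i : ℂ) * (R *ᵥ x) i) := by
    rw [hA, Matrix.mul_assoc, ← Matrix.mulVec_mulVec, ← Matrix.mulVec_mulVec]
    congr 1
    ext i
    simp [rdiag, Matrix.mulVec_diagonal]
  have e2 : A *ᵥ (A *ᵥ x) = P *ᵥ (fun i => (d i : ℂ) * d i * (R *ᵥ x) i) := by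
    rw [hA]; exact sq d d
  have e0 : x = P *ᵥ (R *ᵥ x) := by simp [Matrix.mulVec_mulVec, h1]
  have main : (P * rdiag (s ∘ d) * R) *ᵥ ((P * rdiag (s ∘ d) * R) *ᵥ x) =
      (ε : ℂ) • (A *ᵥ (A *ᵥ x) - ((a : ℂ) + b) • (A *ᵥ x) + ((a : ℂ) * b) • x) := by
    conv_rhs => rw [e2, e1]
    conv_rhs => enter [2, 2, 2]; rw [e0]
    rw [sq, ← Matrix.mulVec_smul, ← Matrix.mulVec_smul, ← Matrix.mulVec_sub, ← Matrix.mulVec_add,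
      ← Matrix.mulVec_smul]
    congr 1
    ext i
    simp only [Pi.smul_apply, Pi.add_apply, Pi.sub_apply, smul_eq_mul, Function.comp]
    by_cases h0 : (R *ᵥ x) i = 0
    · simp [h0]
    · have := hx i h0
      have h' : (s (d i) : ℂ) * s (d i) = ε * ((d i - a) * (d i - b)) := by exact_mod_cast this
      rw [h']; ring
  rw [main]
  simp only [Matrix.mulVec_smul, Matrix.mulVec_add, Matrix.mulVec_sub, dotProduct_smul,
    dotProduct_add, dotProduct_sub, smul_eq_mul]

lemma one_side {N : ℕ} (J A₁ A₂ : Matrix (Fin N) (Fin N) ℂ)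
    (C : Matrix (Fin N) (Fin N) ℂ) (neg : Fin N → Prop)
    (hC : ∀ x : Fin N → ℂ, x ≠ 0 → (∀ i, neg i → (C *ᵥ x) i = 0) →
      0 < (star x ⬝ᵥ (J *ᵥ x)).re)
    (hA₁ : J * A₁ = A₁ᴴ * J) (hA₂ : J * A₂ = A₂ᴴ * J)
    (hd₁ : Diagonalizable A₁) (hd₂ : Diagonalizable A₂)
    (hr₁ : spectrum ℂ A₁ ⊆ Set.range (Complex.ofReal))
    (hr₂ : spectrum ℂ A₂ ⊆ Set.range (Complex.ofReal))
    (Δ : Set ℝ) (hΔopen : IsOpen Δ) (hΔconn : Δ.OrdConnected) :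
    eigCount A₁ Δ ≤ eigCount A₂ Δ +
      Module.finrank ℂ (LinearMap.range (Matrix.toLin' (A₁ - A₂))) + 2 * Nat.card {i // neg i} := by
  classical
  obtain ⟨P, R, d, h1, h2, hA⟩ := exists_real_diag A₁ hd₁ hr₁
  obtain ⟨P', R', d', h1', h2', hA'⟩ := exists_real_diag A₂ hd₂ hr₂
  rw [eigCount_eq A₁ P R d h1 h2 hA, eigCount_eq A₂ P' R' d' h1' h2' hA']
  by_cases hne : Nonempty {i // d i ∈ Δ}
  swap
  · rw [not_nonempty_iff] at hne
    simp
  -- endpoints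
  obtain ⟨im, him⟩ := Finite.exists_min (fun i : {i // d i ∈ Δ} => d i)
  obtain ⟨iM, hiM⟩ := Finite.exists_max (fun i : {i // d i ∈ Δ} => d i)
  obtain ⟨a, ha, haΔ⟩ : ∃ a, a < d im ∧ a ∈ Δ := by
    obtain ⟨l, hl, h⟩ := exists_Ioc_subset_of_mem_nhds (hΔopen.mem_nhds im.2) (exists_lt _)
    obtain ⟨a, ha1, ha2⟩ := exists_between hl
    exact ⟨a, ha2, h ⟨ha1, ha2.le⟩⟩
  obtain ⟨b, hb, hbΔ⟩ : ∃ b, d iM < b ∧ b ∈ Δ := by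
    obtain ⟨l, hl, h⟩ := exists_Ico_subset_of_mem_nhds (hΔopen.mem_nhds iM.2) (exists_gt _)
    obtain ⟨a, ha1, ha2⟩ := exists_between hl
    exact ⟨a, ha1, h ⟨ha1.le, ha2⟩⟩
  have hq1 : ∀ i, d i ∈ Δ → 0 < -1 * ((d i - a) * (d i - b)) := by
    intro i hi
    have := him ⟨i, hi⟩
    have := hiM ⟨i, hi⟩
    simp only at *
    have : 0 < (d i - a) * (b - d i) := mul_pos (by linarith) (by linarith)
    linarith
  have hq2 : ∀ t, t ∉ Δ → 0 ≤ 1 * ((t - a) * (t - b)) := by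
    intro t ht
    by_contra hlt
    apply ht
    apply hΔconn.out haΔ hbΔ
    have hab : a < b := by have := him iM; linarith
    constructor <;> by_contra hh <;> nlinarith
  set s₁ : ℝ → ℝ := fun t => Real.sqrt (-1 * ((t - a) * (t - b))) with hs₁
  set s₂ : ℝ → ℝ := fun t => Real.sqrt (1 * ((t - a) * (t - b))) with hs₂
  set S₁ := P * rdiag (s₁ ∘ d) * R with hS₁
  set S₂ := P' * rdiag (s₂ ∘ d') * R' with hS₂
  by_contra hcon
  push Not at hcon
  let rs : ∀ p : Fin N → Prop, (Fin N → ℂ) →ₗ[ℂ] ({i // p i} → ℂ) :=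
    fun p => LinearMap.funLeft ℂ ℂ (Subtype.val)
  let F : (Fin N → ℂ) →ₗ[ℂ] ({i // d i ∉ Δ} → ℂ) × ({i // d' i ∈ Δ} → ℂ) ×
      (LinearMap.range (Matrix.toLin' (A₁ - A₂))) × ({i // neg i} → ℂ) × ({i // neg i} → ℂ) :=
    ((rs (fun i => d i ∉ Δ)).comp (Matrix.toLin' R)).prod <|
    ((rs (fun i => d' i ∈ Δ)).comp (Matrix.toLin' R')).prod <|
    (Matrix.toLin' (A₁ - A₂)).rangeRestrict.prod <|
    ((rs neg).comp (Matrix.toLin' (C * S₁))).prod ((rs neg).comp (Matrix.toLin' (C * S₂)))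
  have hcard : Nat.card {i // d i ∈ Δ} + Nat.card {i // d i ∉ Δ} = N := by
    rw [Nat.card_eq_fintype_card, Nat.card_eq_fintype_card, Fintype.card_subtype_compl]
    have := Fintype.card_subtype_le (fun i => d i ∈ Δ)
    simp only [Fintype.card_fin] at *
    omega
  have hker : LinearMap.ker F ≠ ⊥ := by
    apply LinearMap.ker_ne_bot_of_finrank_lt
    simp only [Module.finrank_prod, Module.finrank_fintype_fun_eq_card, Fintype.card_fin,
      ← Nat.card_eq_fintype_card]
    simp only [Nat.card_eq_fintype_card (α := Fin N), Fintype.card_fin] at *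
    omega
  obtain ⟨x, hxF, hx0⟩ := Submodule.exists_mem_ne_zero_of_ne_bot hker
  rw [LinearMap.mem_ker] at hxF
  simp only [F, LinearMap.prod_apply, Function.prod, Prod.mk_eq_zero] at hxF
  obtain ⟨c1, c2, c3, c4, c5⟩ := hxF
  have c1 : ∀ i, d i ∉ Δ → (R *ᵥ x) i = 0 := fun i hi => congrFun c1 ⟨i, hi⟩
  have c2 : ∀ i, d' i ∈ Δ → (R' *ᵥ x) i = 0 := fun i hi => congrFun c2 ⟨i, hi⟩
  have c3 : A₁ *ᵥ x = A₂ *ᵥ x := by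
    have := congrArg Subtype.val c3
    simp [Matrix.sub_mulVec] at this
    exact sub_eq_zero.mp this
  have c4 : ∀ i, neg i → (C *ᵥ (S₁ *ᵥ x)) i = 0 := fun i hi => by
    rw [Matrix.mulVec_mulVec]; exact congrFun c4 ⟨i, hi⟩
  have c5 : ∀ i, neg i → (C *ᵥ (S₂ *ᵥ x)) i = 0 := fun i hi => by
    rw [Matrix.mulVec_mulVec]; exact congrFun c5 ⟨i, hi⟩
  have f1 := form_eq J A₁ P R d h1 h2 hA hA₁ s₁ (-1) a b x (by
    intro i hi
    have : d i ∈ Δ := by by_contra h; exact hi (c1 i h)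
    exact Real.mul_self_sqrt (hq1 i this).le)
  have f2 := form_eq J A₂ P' R' d' h1' h2' hA' hA₂ s₂ 1 a b x (by
    intro i hi
    have : d' i ∉ Δ := by intro h; exact hi (c2 i h)
    exact Real.mul_self_sqrt (hq2 _ this))
  rw [← hS₁] at f1
  rw [← hS₂, ← c3] at f2
  have hne1 : S₁ *ᵥ x ≠ 0 := by
    intro h
    apply hx0
    have hR : ∀ i, (R *ᵥ x) i = 0 := by
      intro i
      by_cases hi : d i ∈ Δ
      · have := congrFun (congrArg (fun v => R *ᵥ v) h) i
        simp only [hS₁, Matrix.mulVec_mulVec, ← Matrix.mul_assoc, h2, Matrix.one_mul,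
          Matrix.mulVec_zero] at this
        rw [← Matrix.mulVec_mulVec] at this
        simp only [rdiag, Matrix.mulVec_diagonal, Pi.zero_apply, mul_eq_zero] at this
        rcases this with h' | h'
        · exfalso
          have : s₁ (d i) = 0 := by exact_mod_cast h'
          have h3 := Real.sqrt_pos.mpr (hq1 i hi)
          exact h3.ne' this
        · exact h'
      · exact c1 i hi
    have : x = P *ᵥ (R *ᵥ x) := by simp [Matrix.mulVec_mulVec, h1]
    rw [this, funext hR]
    exact Matrix.mulVec_zero _
  have p1 := hC _ hne1 c4
  have p2 : 0 ≤ (star (S₂ *ᵥ x) ⬝ᵥ (J *ᵥ (S₂ *ᵥ x))).re := by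
    by_cases h : S₂ *ᵥ x = 0
    · simp [h]
    · exact (hC _ h c5).le
  have : star (S₁ *ᵥ x) ⬝ᵥ (J *ᵥ (S₁ *ᵥ x)) = - (star (S₂ *ᵥ x) ⬝ᵥ (J *ᵥ (S₂ *ᵥ x))) := by
    rw [f1, f2]; push_cast; ring
  rw [this, Complex.neg_re] at p1
  linarith

lemma form_re {N : ℕ} (J : Matrix (Fin N) (Fin N) ℂ) (hJ : J.IsHermitian) (x : Fin N → ℂ) :
    (star x ⬝ᵥ (J *ᵥ x)).re = ∑ i, hJ.eigenvalues i *
      Complex.normSq (((hJ.eigenvectorUnitary : Matrix (Fin N) (Fin N) ℂ)ᴴ *ᵥ x) i) := by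
  set U := (hJ.eigenvectorUnitary : Matrix (Fin N) (Fin N) ℂ) with hU
  have hs : J = U * rdiag hJ.eigenvalues * Uᴴ := by
    have := hJ.spectral_theorem
    rw [Unitary.conjStarAlgAut_apply] at this
    exact this
  have : star x ⬝ᵥ (J *ᵥ x) = star (Uᴴ *ᵥ x) ⬝ᵥ (rdiag hJ.eigenvalues *ᵥ (Uᴴ *ᵥ x)) := by
    conv_lhs => rw [hs]
    rw [Matrix.star_mulVec, Matrix.conjTranspose_conjTranspose, ← Matrix.dotProduct_mulVec,
      Matrix.mulVec_mulVec, Matrix.mulVec_mulVec, Matrix.mul_assoc]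
  rw [this]
  simp only [dotProduct, rdiag, Matrix.mulVec_diagonal, Complex.re_sum]
  refine Finset.sum_congr rfl fun i _ => ?_
  simp [Complex.normSq_apply]
  ring

lemma pos_of {N : ℕ} (J : Matrix (Fin N) (Fin N) ℂ) (hJ : J.IsHermitian) (hJinv : IsUnit J.det)
    (σ : ℝ) (hσ : σ ≠ 0) (x : Fin N → ℂ) (hx : x ≠ 0)
    (h : ∀ i, σ * hJ.eigenvalues i < 0 →
      ((hJ.eigenvectorUnitary : Matrix (Fin N) (Fin N) ℂ)ᴴ *ᵥ x) i = 0) :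
    0 < σ * (star x ⬝ᵥ (J *ᵥ x)).re := by
  rw [form_re J hJ, Finset.mul_sum]
  have hev : ∀ i, hJ.eigenvalues i ≠ 0 := by
    intro i hi
    have := hJ.det_eq_prod_eigenvalues
    rw [Finset.prod_eq_zero (Finset.mem_univ i) (by simp [hi])] at this
    exact hJinv.ne_zero this
  have hnn : ∀ i, 0 ≤ σ * (hJ.eigenvalues i *
      Complex.normSq (((hJ.eigenvectorUnitary : Matrix (Fin N) (Fin N) ℂ)ᴴ *ᵥ x) i)) := by
    intro i
    by_cases hi : σ * hJ.eigenvalues i < 0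
    · simp [h i hi]
    · rw [← mul_assoc]
      exact mul_nonneg (not_lt.mp hi) (Complex.normSq_nonneg _)
  apply Finset.sum_pos' (fun i _ => hnn i)
  by_contra hall
  push Not at hall
  apply hx
  have hz : ∀ i, ((hJ.eigenvectorUnitary : Matrix (Fin N) (Fin N) ℂ)ᴴ *ᵥ x) i = 0 := by
    intro i
    have := le_antisymm (hall i (Finset.mem_univ i)) (hnn i)
    simpa [hσ, hev i] using this
  have hU : (hJ.eigenvectorUnitary : Matrix (Fin N) (Fin N) ℂ) *
      (hJ.eigenvectorUnitary : Matrix (Fin N) (Fin N) ℂ)ᴴ = 1 :=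
    Unitary.coe_mul_star_self hJ.eigenvectorUnitary
  have : x = (hJ.eigenvectorUnitary : Matrix (Fin N) (Fin N) ℂ) *ᵥ
      ((hJ.eigenvectorUnitary : Matrix (Fin N) (Fin N) ℂ)ᴴ *ᵥ x) := by
    rw [Matrix.mulVec_mulVec, hU, Matrix.one_mulVec]
  rw [this, funext hz]
  exact Matrix.mulVec_zero _

theorem stmt15 {N : ℕ} (J A₁ A₂ : Matrix (Fin N) (Fin N) ℂ)
    (hJinv : IsUnit J.det) (hJ : J.IsHermitian) (κp κm : ℕ)
    (hκp : (Finset.univ.filter fun i => 0 < hJ.eigenvalues i).card = κp)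
    (hκm : (Finset.univ.filter fun i => hJ.eigenvalues i < 0).card = κm)
    (hA₁ : J * A₁ = A₁ᴴ * J) (hA₂ : J * A₂ = A₂ᴴ * J)
    (hd₁ : Diagonalizable A₁) (hd₂ : Diagonalizable A₂)
    (hr₁ : spectrum ℂ A₁ ⊆ Set.range (Complex.ofReal))
    (hr₂ : spectrum ℂ A₂ ⊆ Set.range (Complex.ofReal))
    (n : ℕ)
    (hn : N - Module.finrank ℂ (LinearMap.ker (Matrix.toLin' (A₁ - A₂))) = n)
    (Δ : Set ℝ) (hΔopen : IsOpen Δ) (hΔconn : Δ.OrdConnected) :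
    |(eigCount A₁ Δ : ℤ) - eigCount A₂ Δ| ≤ n + 2 * min κp κm := by
  have hC1 : ∀ x : Fin N → ℂ, x ≠ 0 → (∀ i, hJ.eigenvalues i < 0 →
      ((hJ.eigenvectorUnitary : Matrix (Fin N) (Fin N) ℂ)ᴴ *ᵥ x) i = 0) →
      0 < (star x ⬝ᵥ (J *ᵥ x)).re := by
    intro x hx h
    simpa using pos_of J hJ hJinv 1 one_ne_zero x hx (by simpa using h)
  have hC2 : ∀ x : Fin N → ℂ, x ≠ 0 → (∀ i, 0 < hJ.eigenvalues i →
      ((hJ.eigenvectorUnitary : Matrix (Fin N) (Fin N) ℂ)ᴴ *ᵥ x) i = 0) →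
      0 < (star x ⬝ᵥ ((-J) *ᵥ x)).re := by
    intro x hx h
    have := pos_of J hJ hJinv (-1) (by norm_num) x hx (by simpa using h)
    simpa [Matrix.neg_mulVec] using this
  have hA₁' : -J * A₁ = A₁ᴴ * -J := by simp [hA₁]
  have hA₂' : -J * A₂ = A₂ᴴ * -J := by simp [hA₂]
  have e1 : Nat.card {i // hJ.eigenvalues i < 0} = κm := by
    rw [← hκm, Nat.card_eq_fintype_card, Fintype.card_subtype]
  have e2 : Nat.card {i // 0 < hJ.eigenvalues i} = κp := by
    rw [← hκp, Nat.card_eq_fintype_card, Fintype.card_subtype]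
  have r1 : Module.finrank ℂ (LinearMap.range (Matrix.toLin' (A₁ - A₂))) = n := by
    have := LinearMap.finrank_range_add_finrank_ker (Matrix.toLin' (A₁ - A₂))
    simp only [Module.finrank_fintype_fun_eq_card, Fintype.card_fin] at this
    omega
  have r2 : Module.finrank ℂ (LinearMap.range (Matrix.toLin' (A₂ - A₁))) = n := by
    rw [← r1, ← neg_sub A₁ A₂, map_neg, LinearMap.range_neg]
  have b1 := one_side J A₁ A₂ _ _ hC1 hA₁ hA₂ hd₁ hd₂ hr₁ hr₂ Δ hΔopen hΔconn
  have b2 := one_side J A₂ A₁ _ _ hC1 hA₂ hA₁ hd₂ hd₁ hr₂ hr₁ Δ hΔopen hΔconn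
  have b3 := one_side (-J) A₁ A₂ _ _ hC2 hA₁' hA₂' hd₁ hd₂ hr₁ hr₂ Δ hΔopen hΔconn
  have b4 := one_side (-J) A₂ A₁ _ _ hC2 hA₂' hA₁' hd₂ hd₁ hr₂ hr₁ Δ hΔopen hΔconn
  rw [e1, r1] at b1
  rw [e1, r2] at b2
  rw [e2, r1] at b3
  rw [e2, r2] at b4
  rw [abs_le]
  constructor <;> omega
end
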